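/- Let t ≥ 1 be an integer, and set μ_t(n) := √(6n)/π − t/2 + 3/π² + δ_t/4 and σ_t(n) := ((π² − 6)√(6n)/π³)^{1/2}. Then for every real r, the normalized moment generating function converges pointwise to that of the standard Gaussian: lim_{n→∞} (1/sc(n)) Σ_{λ ∈ SC(n)} exp( r (N_t(λ) − μ_t(n)) / σ_t(n) ) = e^{r²/2}. -/

import Mathlib

open scoped Real Classical
open Complex Filter Asymptotics

noncomputable section

/-- The conjugate part `λ'_k`: the number of parts of `P` that are at least `k`. -/
def colLen {n : ℕ} (P : n.Partition) (k : ℕ) : ℕ :=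
  Multiset.card (P.parts.filter (fun p => k ≤ p))

/-- The part `λ_j` (the `j`-th largest part, 1-indexed), recovered by conjugating twice. -/
def rowLen {n : ℕ} (P : n.Partition) (j : ℕ) : ℕ :=
  ((Finset.Icc 1 n).filter (fun k => j ≤ colLen P k)).card

/-- The hook number `h(j,k) = (λ_j - j) + (λ'_k - k) + 1` of the cell `(j,k)` (1-indexed). -/
def hookNum {n : ℕ} (P : n.Partition) (j k : ℕ) : ℤ :=
  ((rowLen P j : ℤ) - j) + ((colLen P k : ℤ) - k) + 1

/-- `N_t(λ)`: the number of cells of the Young diagram of `λ` with hook number `t`. -/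
def Nhook {n : ℕ} (t : ℕ) (P : n.Partition) : ℕ :=
  (((Finset.Icc 1 n) ×ˢ (Finset.Icc 1 n)).filter
    (fun c => c.2 ≤ rowLen P c.1 ∧ hookNum P c.1 c.2 = (t : ℤ))).card

/-- A partition is self-conjugate if `λ_k = λ'_k` for all `k ≥ 1`. -/
def IsSelfConjugate {n : ℕ} (P : n.Partition) : Prop :=
  ∀ k, 1 ≤ k → rowLen P k = colLen P k

/-- `SC(n)`, the set of self-conjugate partitions of `n`. -/
def SC (n : ℕ) : Finset (Nat.Partition n) :=
  Finset.univ.filter (fun P => IsSelfConjugate P)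

/-- `δ_t = 1` if `t` is odd, else `0`. -/
def delta (t : ℕ) : ℝ := if Odd t then 1 else 0

/-- The region `D_θ = { r e^{iα} : r ≥ 0, |α| ≤ θ }`. -/
def Dset (θ : ℝ) : Set ℂ := {z | z = 0 ∨ |z.arg| ≤ θ}

/-- The filter of punctured neighborhoods of `0` intersected with `D_θ`. -/
def near0 (θ : ℝ) : Filter ℂ := nhdsWithin 0 (Dset θ \ {0})

/-- The dilogarithm `Li₂(X) = -∫₀¹ log(1 - Xu)/u du` (principal logarithm). -/
def Li2 (X : ℂ) : ℂ := -∫ u in (0:ℝ)..1, Complex.log (1 - X * u) / (u : ℂ)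

/-- The real dilogarithm, for real arguments `x < 1`. -/
def Li2R (x : ℝ) : ℝ := -∫ u in (0:ℝ)..1, Real.log (1 - x * u) / u

/-- The principal complex square root. -/
def csqrt (z : ℂ) : ℂ := z ^ ((1:ℂ)/2)

/-- The infinite Pochhammer symbol `(a;q)_∞ = ∏_{j ≥ 0} (1 - a q^j)`. -/
def pochInf (a q : ℂ) : ℂ := ∏' j : ℕ, (1 - a * q ^ j)

/-- The finite Pochhammer symbol `(a;q)_n = ∏_{j=0}^{n-1} (1 - a q^j)`. -/
def pochN (a q : ℂ) (n : ℕ) : ℂ := ∏ j ∈ Finset.range n, (1 - a * q ^ j)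

/-- `C_T^+ = 1 + √((1-T)/(1+T))`. -/
def Cp (T : ℝ) : ℂ := 1 + csqrt ((1 - (T:ℂ)) / (1 + (T:ℂ)))

/-- `C_T^- = 1 - √((1-T)/(1+T))`. -/
def Cm (T : ℝ) : ℂ := 1 - csqrt ((1 - (T:ℂ)) / (1 + (T:ℂ)))

/-- `H*(T;q) = (1/(2T)) [ C_T^+ (√(1-T²);-q)_∞ + C_T^- (-√(1-T²);-q)_∞ ]`. -/
def Hstar (T : ℝ) (q : ℂ) : ℂ :=
  1 / (2 * (T:ℂ)) * (Cp T * pochInf (csqrt (1 - (T:ℂ)^2)) (-q)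
    + Cm T * pochInf (-csqrt (1 - (T:ℂ)^2)) (-q))

/-- `α_T^+ = (1/(2T)) ( C_T^+ + C_T^- √((1+√(1-T²))/(1-√(1-T²))) )`. -/
def alphaP (T : ℝ) : ℂ :=
  1 / (2 * (T:ℂ)) *
    (Cp T + Cm T * csqrt ((1 + csqrt (1 - (T:ℂ)^2)) / (1 - csqrt (1 - (T:ℂ)^2))))

/-- `α_T^- = (1/(2T)) ( C_T^+ - C_T^- √((1+√(1-T²))/(1-√(1-T²))) )`. -/
def alphaM (T : ℝ) : ℂ :=
  1 / (2 * (T:ℂ)) *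
    (Cp T - Cm T * csqrt ((1 + csqrt (1 - (T:ℂ)^2)) / (1 - csqrt (1 - (T:ℂ)^2))))

/-- `b_t(T)` from Proposition: saddle-point constant. -/
def bt (t : ℕ) (T : ℝ) : ℝ :=
  if Even t then (1/2) * Real.sqrt (π^2/6 - Li2R (1 - T^2))
  else (1/2) * Real.sqrt (π^2/6 - ((t-1 : ℝ)/t) * Li2R (1 - T^2))

end

section

open scoped Topology

lemma lt_card_filter_range_iff {Q : ℕ → Prop} [DecidablePred Q] {n : ℕ} (hanti : ∀ i j, i ≤ j → Q j → Q i)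
    (hn : ∀ i, Q i → i < n) (i : ℕ) : i < ((Finset.range n).filter Q).card ↔ Q i := by
  constructor
  · intro h
    by_contra hi
    have : (Finset.range n).filter Q ⊆ Finset.range i := by
      intro k hk
      simp only [Finset.mem_filter, Finset.mem_range] at hk ⊢
      by_contra hik
      exact hi (hanti i k (not_lt.mp hik) hk.2)
    have := Finset.card_le_card this
    rw [Finset.card_range] at this
    omega
  · intro h
    have : Finset.range (i + 1) ⊆ (Finset.range n).filter Q := by
      intro k hk
      simp only [Finset.mem_filter, Finset.mem_range] at hk ⊢
      have hk' := hanti k i (by omega) h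
      exact ⟨hn k hk', hk'⟩
    have := Finset.card_le_card this
    rw [Finset.card_range] at this
    omega

/-- The Frobenius coordinates of the symmetric diagram with row lengths `f`. -/
noncomputable def frob (f : ℕ → ℕ) (n : ℕ) : Finset ℕ :=
  (Finset.range n).filter (fun e => ∃ i, f i = i + 1 + e)

lemma mem_frob {f : ℕ → ℕ} {n : ℕ} (hn : ∀ i, f i ≤ n) (e : ℕ) :
    e ∈ frob f n ↔ ∃ i, f i = i + 1 + e := by
  simp only [frob, Finset.mem_filter, Finset.mem_range, and_iff_right_iff_imp]
  rintro ⟨i, hi⟩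
  have := hn i
  omega

lemma antitone_of_symm {f : ℕ → ℕ} (hs : ∀ i j, j < f i ↔ i < f j) : Antitone f := by
  intro i i' h
  by_contra hlt
  have h1 := (hs i' (f i)).1 (not_le.mp hlt)
  have h2 := (hs (f i) i).1 (lt_of_le_of_lt h h1)
  exact lt_irrefl _ h2

lemma frob_eq_image {f : ℕ → ℕ} {n : ℕ} (hn : ∀ i, f i ≤ n)
    (x : ℕ) : (frob f n).filter (fun e => x ≤ e) =
      ((Finset.range n).filter (fun i => i + x < f i)).image (fun i => f i - (i + 1)) := by
  ext e
  simp only [Finset.mem_filter, mem_frob hn, Finset.mem_image, Finset.mem_range]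
  constructor
  · rintro ⟨⟨i, hi⟩, hx⟩
    have := hn i
    exact ⟨i, by omega, by omega⟩
  · rintro ⟨i, ⟨_, h⟩, rfl⟩
    exact ⟨⟨i, by omega⟩, by omega⟩

lemma injOn_frob {f : ℕ → ℕ} (hs : ∀ i j, j < f i ↔ i < f j) (n x : ℕ) :
    Set.InjOn (fun i => f i - (i + 1)) ((Finset.range n).filter (fun i => i + x < f i)) := by
  intro i hi j hj hij
  simp only [Finset.coe_filter, Set.mem_ofPred_eq] at hi hj hij
  rcases lt_trichotomy i j with h | h | h
  · have := antitone_of_symm hs h.le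
    omega
  · exact h
  · have := antitone_of_symm hs h.le
    omega

lemma lt_iff_frob {f : ℕ → ℕ} {n : ℕ} (hs : ∀ i j, j < f i ↔ i < f j) (hn : ∀ i, f i ≤ n)
    (i x : ℕ) : i + x < f i ↔ i < ((frob f n).filter (fun e => x ≤ e)).card := by
  rw [frob_eq_image hn, Finset.card_image_of_injOn (injOn_frob hs n x),
    lt_card_filter_range_iff]
  · intro i j hij h
    have := antitone_of_symm hs hij
    omega
  · intro i h
    have := hn i
    omega

lemma sum_eq_sum_frob {f : ℕ → ℕ} {n : ℕ} (hs : ∀ i j, j < f i ↔ i < f j) (hn : ∀ i, f i ≤ n) :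
    ∑ i ∈ Finset.range n, f i = ∑ e ∈ frob f n, (2 * e + 1) := by
  have h1 : frob f n = (frob f n).filter (fun e => 0 ≤ e) := by simp
  rw [h1, frob_eq_image hn, Finset.sum_image (injOn_frob hs n 0), Finset.sum_filter]
  have h2 : ∑ i ∈ Finset.range n, min (f i) i = ∑ j ∈ Finset.range n, (f j - (j + 1)) := by
    have hl : ∀ i ∈ Finset.range n, min (f i) i =
        ((Finset.range n).filter (fun j => j < i ∧ j < f i)).card := by
      intro i hi
      rw [← Finset.card_range (min (f i) i)]
      congr 1
      ext j
      simp only [Finset.mem_range, Finset.mem_filter] at hi ⊢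
      omega
    have hr : ∀ j ∈ Finset.range n, f j - (j + 1) =
        ((Finset.range n).filter (fun i => j < i ∧ j < f i)).card := by
      intro j hj
      rw [← Nat.card_Ico (j + 1) (f j)]
      congr 1
      ext i
      have := hn j
      simp only [Finset.mem_Ico, Finset.mem_filter, Finset.mem_range, hs i j]
      omega
    rw [Finset.sum_congr rfl hl, Finset.sum_congr rfl hr]
    exact Finset.sum_card_bipartiteAbove_eq_sum_card_bipartiteBelow (fun i j => j < i ∧ j < f i)
  have h3 : ∑ i ∈ Finset.range n, f i
      = ∑ i ∈ Finset.range n, (f i - i) + ∑ i ∈ Finset.range n, min (f i) i := by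
    rw [← Finset.sum_add_distrib]
    exact Finset.sum_congr rfl fun i _ => by omega
  rw [h3, h2, ← Finset.sum_add_distrib]
  refine Finset.sum_congr rfl fun i _ => ?_
  split_ifs <;> omega

lemma colLen_antitone {n : ℕ} (P : n.Partition) : Antitone (colLen P) := fun _ _ h =>
  Multiset.card_le_card (Multiset.monotone_filter_right _ fun _ hp => h.trans hp)

lemma colLen_eq_zero {n : ℕ} (P : n.Partition) {k : ℕ} (h : n < k) : colLen P k = 0 := by
  rw [colLen, Multiset.card_eq_zero, Multiset.filter_eq_nil]
  intro p hp
  have := P.le_of_mem_parts hp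
  omega

lemma sum_colLen {n : ℕ} (P : n.Partition) :
    ∑ k ∈ Finset.range n, colLen P (k + 1) = n := by
  have key : ∀ s : Multiset ℕ, (∀ p ∈ s, p ≤ n) →
      ∑ k ∈ Finset.range n, Multiset.card (s.filter (fun p => k + 1 ≤ p)) = s.sum := by
    intro s
    induction s using Multiset.induction_on with
    | empty => simp
    | cons a s ih =>
      intro h
      have ha := h a (Multiset.mem_cons_self a s)
      have := ih fun p hp => h p (Multiset.mem_cons_of_mem hp)
      rw [Multiset.sum_cons, ← this]
      have hcard : a = ∑ k ∈ Finset.range n, if k + 1 ≤ a then 1 else 0 := by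
        rw [← Finset.card_filter]
        conv_lhs => rw [← Finset.card_range a]
        congr 1
        ext k
        simp only [Finset.mem_range, Finset.mem_filter]
        omega
      conv_rhs => rw [hcard]
      rw [← Finset.sum_add_distrib]
      refine Finset.sum_congr rfl fun k _ => ?_
      rw [← Multiset.countP_eq_card_filter, ← Multiset.countP_eq_card_filter,
        Multiset.countP_cons]
      split_ifs <;> omega
  exact (key P.parts fun p hp => P.le_of_mem_parts hp).trans P.parts_sum

lemma colLen_le {n : ℕ} (P : n.Partition) (k : ℕ) : colLen P (k + 1) ≤ n := by
  rcases Nat.lt_or_ge n (k + 1) with h | h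
  · simp [colLen_eq_zero P h]
  · conv_rhs => rw [← sum_colLen P]
    exact Finset.single_le_sum (f := fun k => colLen P (k + 1)) (fun _ _ => Nat.zero_le _)
      (Finset.mem_range.2 (by omega))

lemma rowLen_eq {n : ℕ} (P : n.Partition) (j : ℕ) :
    rowLen P j = ((Finset.range n).filter (fun k => j ≤ colLen P (k + 1))).card := by
  rw [rowLen]
  refine Finset.card_bij' (fun k _ => k - 1) (fun k _ => k + 1) ?_ ?_ ?_ ?_
  · intro k hk
    simp only [Finset.mem_filter, Finset.mem_Icc, Finset.mem_range] at hk ⊢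
    rw [Nat.sub_add_cancel hk.1.1]
    exact ⟨by omega, hk.2⟩
  · intro k hk
    simp only [Finset.mem_filter, Finset.mem_Icc, Finset.mem_range] at hk ⊢
    exact ⟨by omega, hk.2⟩
  · intro k hk
    simp only [Finset.mem_filter, Finset.mem_Icc] at hk
    omega
  · intro k _
    simp

lemma lt_rowLen_iff {n : ℕ} (P : n.Partition) (i j : ℕ) :
    j < rowLen P (i + 1) ↔ i < colLen P (j + 1) := by
  rw [rowLen_eq, lt_card_filter_range_iff]
  · omega
  · intro a b hab h
    exact h.trans (colLen_antitone P (by omega))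
  · intro k hk
    by_contra h
    rw [colLen_eq_zero P (by omega)] at hk
    omega

lemma isSelfConjugate_iff {n : ℕ} (P : n.Partition) : IsSelfConjugate P ↔
    ∀ i j, j < colLen P (i + 1) ↔ i < colLen P (j + 1) := by
  constructor
  · intro h i j
    rw [← h (i + 1) (by omega), lt_rowLen_iff]
  · intro h k hk
    obtain ⟨k, rfl⟩ : ∃ l, k = l + 1 := ⟨k - 1, by omega⟩
    refine eq_of_forall_lt_iff fun j => ?_
    rw [lt_rowLen_iff, h]

/-- The Frobenius coordinates of a self-conjugate partition. -/
noncomputable def frobP {n : ℕ} (P : n.Partition) : Finset ℕ := frob (fun i => colLen P (i + 1)) n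

lemma parts_eq_of_colLen {n : ℕ} {P Q : n.Partition}
    (h : ∀ k, colLen P (k + 1) = colLen Q (k + 1)) : P = Q := by
  have key : ∀ (R : n.Partition) (k : ℕ), 
      colLen R (k + 1) = R.parts.count (k + 1) + colLen R (k + 1 + 1) := by
    intro R k
    simp only [colLen]
    rw [Multiset.count, ← Multiset.countP_eq_card_filter, ← Multiset.countP_eq_card_filter]
    induction R.parts using Multiset.induction_on with
    | empty => simp
    | cons a s ih =>
      simp only [Multiset.countP_cons, ih]
      split_ifs <;> omega
  ext a
  rcases Nat.eq_zero_or_pos a with rfl | ha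
  · rw [Multiset.count_eq_zero_of_notMem fun h0 => lt_irrefl _ (P.parts_pos h0),
      Multiset.count_eq_zero_of_notMem fun h0 => lt_irrefl _ (Q.parts_pos h0)]
  · obtain ⟨k, rfl⟩ : ∃ l, a = l + 1 := ⟨a - 1, by omega⟩
    have h1 := key P k
    have h2 := key Q k
    have h3 := h k
    have h4 := h (k + 1)
    omega

lemma frobP_injOn (n : ℕ) : Set.InjOn (frobP (n := n)) (SC n : Set n.Partition) := by
  intro P hP Q hQ h
  have hP' := (isSelfConjugate_iff P).1 (by simpa [SC] using hP)
  have hQ' := (isSelfConjugate_iff Q).1 (by simpa [SC] using hQ)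
  have key : ∀ i j, i ≤ j → (j < colLen P (i + 1) ↔ j < colLen Q (i + 1)) := by
    intro i j hij
    obtain ⟨x, rfl⟩ := Nat.exists_eq_add_of_le hij
    have h1 := lt_iff_frob (f := fun i => colLen P (i + 1)) hP' (colLen_le P) i x
    have h2 := lt_iff_frob (f := fun i => colLen Q (i + 1)) hQ' (colLen_le Q) i x
    simp only [frobP] at h
    rw [h1, h2, h]
  refine parts_eq_of_colLen fun i => eq_of_forall_lt_iff fun j => ?_
  rcases le_total i j with hij | hij
  · exact key i j hij
  · rw [hP', hQ', key j i hij]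

lemma sum_frobP {n : ℕ} {P : n.Partition} (hP : IsSelfConjugate P) :
    ∑ e ∈ frobP P, (2 * e + 1) = n := by
  rw [frobP, ← sum_eq_sum_frob (f := fun i => colLen P (i + 1)) ((isSelfConjugate_iff P).1 hP)
    (colLen_le P), sum_colLen]

lemma exists_symm_frob {n : ℕ} {E : Finset ℕ} (hE : ∑ e ∈ E, (2 * e + 1) = n) :
    ∃ f : ℕ → ℕ, (∀ i j, j < f i ↔ i < f j) ∧ (∀ i, f i ≤ n) ∧ frob f n = E := by
  set G : ℕ → ℕ := fun x => (E.filter (fun e => x ≤ e)).card with hG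
  have hGstep : ∀ x, G x = G (x + 1) + if x ∈ E then 1 else 0 := by
    intro x
    have : E.filter (fun e => x ≤ e) = E.filter (fun e => x + 1 ≤ e) ∪ E.filter (fun e => x = e) := by
      ext e
      simp only [Finset.mem_filter, Finset.mem_union]
      have : x ≤ e ↔ x + 1 ≤ e ∨ x = e := by omega
      rw [this]
      tauto
    simp only [hG]
    rw [this, Finset.card_union_of_disjoint]
    · rw [Finset.filter_eq]
      split_ifs <;> simp
    · rw [Finset.disjoint_filter]
      intro e _ h h'
      omega
  have hGanti : ∀ x, G (x + 1) ≤ G x := fun x => by rw [hGstep x]; omega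
  have hGsucc : ∀ x, G x ≤ G (x + 1) + 1 := fun x => by rw [hGstep x]; split_ifs <;> omega
  have hGn : ∀ x, G x * (2 * x + 1) ≤ n := by
    intro x
    rw [← hE]
    calc G x * (2 * x + 1) = ∑ e ∈ E.filter (fun e => x ≤ e), (2 * x + 1) := by
          rw [Finset.sum_const, smul_eq_mul]
      _ ≤ ∑ e ∈ E.filter (fun e => x ≤ e), (2 * e + 1) :=
          Finset.sum_le_sum fun e he => by
            have := (Finset.mem_filter.1 he).2
            omega
      _ ≤ _ := Finset.sum_le_sum_of_subset (Finset.filter_subset _ _)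
  set D : ℕ → ℕ → Prop := fun i j => min i j < G (max i j - min i j) with hD
  have hDs : ∀ i j, D i j ↔ D j i := fun i j => by simp only [hD, min_comm i j, max_comm i j]
  have hDn : ∀ i j, D i j → j < n := by
    intro i j h
    have h1 := hGn (max i j - min i j)
    simp only [hD] at h
    have h2 : (min i j + 1) * (2 * (max i j - min i j) + 1) ≤ n :=
      (Nat.mul_le_mul_right _ h).trans h1
    have h3 : min i j + 1 + (max i j - min i j) ≤
        (min i j + 1) * (2 * (max i j - min i j) + 1) := by
      generalize max i j - min i j = x
      nlinarith [Nat.zero_le (min i j * x)]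
    omega
  have hDstep : ∀ i j, D i (j + 1) → D i j := by
    intro i j h
    simp only [hD] at h ⊢
    rcases Nat.lt_or_ge j i with hij | hij
    · have e1 : max i (j + 1) - min i (j + 1) = i - (j + 1) := by omega
      have e2 : max i j - min i j = i - (j + 1) + 1 := by omega
      rw [e1] at h
      rw [e2]
      have := hGsucc (i - (j + 1))
      omega
    · have e1 : max i (j + 1) - min i (j + 1) = (j - i) + 1 := by omega
      have e2 : max i j - min i j = j - i := by omega
      rw [e1] at h
      rw [e2]
      have := hGanti (j - i)
      omega
  have hDanti : ∀ i j k, j ≤ k → D i k → D i j := by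
    intro i j k hjk
    induction hjk with
    | refl => exact id
    | step _ ih => exact fun h => ih (hDstep _ _ h)
  set f : ℕ → ℕ := fun i => ((Finset.range n).filter (D i)).card with hf
  have hfD : ∀ i j, j < f i ↔ D i j := fun i j =>
    lt_card_filter_range_iff (hDanti i) (hDn i) j
  have hfn : ∀ i, f i ≤ n := fun i =>
    (Finset.card_le_card (Finset.filter_subset _ _)).trans (Finset.card_range n).le
  refine ⟨f, fun i j => by rw [hfD, hfD, hDs], hfn, ?_⟩
  ext e
  rw [mem_frob hfn]
  have hDe : ∀ i x, D i (i + x) ↔ i < G x := by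
    intro i x
    simp only [hD]
    rw [min_eq_left (by omega), max_eq_right (by omega), Nat.add_sub_cancel_left]
  have h1 : ∀ i, f i = i + 1 + e ↔ i < G e ∧ ¬ i < G (e + 1) := by
    intro i
    rw [← hDe, ← hDe, ← hfD, ← hfD]
    omega
  simp only [h1]
  have := hGstep e
  constructor
  · rintro ⟨i, h⟩
    by_contra he
    rw [if_neg he] at this
    omega
  · intro he
    rw [if_pos he] at this
    exact ⟨G (e + 1), by omega⟩

lemma exists_frobP_eq {n : ℕ} {E : Finset ℕ} (hE : ∑ e ∈ E, (2 * e + 1) = n) :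
    ∃ P ∈ SC n, frobP P = E := by
  obtain ⟨f, hs, hn, hfE⟩ := exists_symm_frob hE
  have hsum : ((Finset.range n).val.map f).sum = n := by
    have := sum_eq_sum_frob hs hn
    rw [hfE, hE] at this
    exact this
  set P := Nat.Partition.ofSums n _ hsum with hP
  have hcol : ∀ k, colLen P (k + 1) = f k := by
    intro k
    simp only [colLen, hP, Nat.Partition.ofSums]
    rw [Multiset.filter_filter, ← Multiset.countP_eq_card_filter, Multiset.countP_map,
      ← Finset.filter_val, Finset.card_val]
    conv_rhs => rw [← Finset.card_range (f k)]
    congr 1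
    ext i
    have h1 := hs i k
    have h2 := hn k
    simp only [Finset.mem_filter, Finset.mem_range]
    omega
  refine ⟨P, ?_, ?_⟩
  · simp only [SC, Finset.mem_filter, Finset.mem_univ, true_and]
    rw [isSelfConjugate_iff]
    intro i j
    rw [hcol, hcol, hs]
  · simp only [frobP, hcol]
    exact hfE

/-- The number of `m ∈ E` with `m ≥ t` and `m - t ∉ E`. -/
noncomputable def descents (t : ℕ) (E : Finset ℕ) : ℕ :=
  (E.filter (fun m => t ≤ m ∧ m - t ∉ E)).card

lemma not_exists_frob_iff {f : ℕ → ℕ} (hs : ∀ i j, j < f i ↔ i < f j) {n : ℕ}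
    (hn : ∀ i, f i ≤ n) (x : ℕ) : (¬ ∃ i, f i = i + 1 + x) ↔ ∃ i, f i + x = i := by
  constructor
  · intro h
    have hex : ∃ i, f i ≤ i + x := ⟨n, (hn n).trans (by omega)⟩
    set i₀ := Nat.find hex with hi₀
    have h0 : f i₀ ≤ i₀ + x := Nat.find_spec hex
    refine ⟨i₀ + x, ?_⟩
    suffices f (i₀ + x) = i₀ by omega
    refine eq_of_forall_lt_iff fun i => ?_
    rw [← hs]
    constructor
    · intro hi
      by_contra hc
      have := antitone_of_symm hs (not_lt.1 hc)
      omega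
    · intro hi
      have h1 : ¬ f (i₀ - 1) ≤ i₀ - 1 + x := Nat.find_min hex (by omega)
      have h2 : f (i₀ - 1) ≠ i₀ - 1 + 1 + x := fun hc => h ⟨_, hc⟩
      have := antitone_of_symm hs (show i ≤ i₀ - 1 by omega)
      omega
  · rintro ⟨j, hj⟩ ⟨i, hi⟩
    have := hs i j
    omega

lemma Nhook_bounds {n t : ℕ} (ht : 1 ≤ t) {P : n.Partition} (hP : IsSelfConjugate P) :
    2 * descents t (frobP P) ≤ Nhook t P ∧ Nhook t P ≤ 2 * descents t (frobP P) + t := by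
  have hs := (isSelfConjugate_iff P).1 hP
  have hn := colLen_le P
  have hnot := fun x => not_exists_frob_iff (f := fun i => colLen P (i + 1)) hs hn x
  have hmem : ∀ x, x ∈ frobP P ↔ ∃ i, colLen P (i + 1) = i + 1 + x := fun x => mem_frob hn x
  have hanti := colLen_antitone P
  set c := colLen P with hc
  set S := ((Finset.Icc 1 n) ×ˢ (Finset.Icc 1 n)).filter
    (fun x : ℕ × ℕ => x.2 ≤ rowLen P x.1 ∧ hookNum P x.1 x.2 = (t : ℤ)) with hS
  have hmemS : ∀ x : ℕ × ℕ, x ∈ S ↔ (1 ≤ x.1 ∧ 1 ≤ x.2 ∧ x.2 ≤ c x.1 ∧ x.1 ≤ c x.2 ∧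
      (c x.1 : ℤ) - x.1 + ((c x.2 : ℤ) - x.2) + 1 = t) := by
    rintro ⟨j, k⟩
    rw [hS, Finset.mem_filter, Finset.mem_product, Finset.mem_Icc, Finset.mem_Icc]
    dsimp only
    rw [show hookNum P j k = (rowLen P j : ℤ) - j + ((c k : ℤ) - k) + 1 from rfl]
    constructor
    · rintro ⟨⟨⟨h1, h2⟩, h3, h4⟩, h5, h6⟩
      rw [hP j h1] at h5 h6
      have := hs (j - 1) (k - 1)
      rw [Nat.sub_add_cancel h1, Nat.sub_add_cancel h3] at this
      change k ≤ c j at h5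
      exact ⟨h1, h3, h5, by omega, h6⟩
    · rintro ⟨h1, h3, h5, h6, h7⟩
      have e1 := hn (j - 1)
      have e2 := hn (k - 1)
      rw [Nat.sub_add_cancel h1] at e1
      rw [Nat.sub_add_cancel h3] at e2
      rw [hP j h1]
      exact ⟨⟨⟨h1, by omega⟩, h3, by omega⟩, h5, h7⟩
  have hinj : ∀ x y : ℕ × ℕ, x ∈ S → y ∈ S → (c x.1 : ℤ) - x.1 = (c y.1 : ℤ) - y.1 → x = y := by
    rintro ⟨j, k⟩ ⟨j', k'⟩ hx hy h
    have hx := (hmemS _).1 hx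
    have hy := (hmemS _).1 hy
    dsimp only at hx hy h
    have aux : ∀ a b, (c a : ℤ) - a = (c b : ℤ) - b → a = b := by
      intro a b hab
      rcases lt_trichotomy a b with h | h | h
      · have := hanti h.le
        omega
      · exact h
      · have := hanti h.le
        omega
    exact Prod.ext (aux _ _ h) (aux k k' (by omega))
  set S1 := S.filter (fun x => (t : ℤ) ≤ (c x.1 : ℤ) - x.1) with hS1
  set S2 := S.filter (fun x => (t : ℤ) ≤ (c x.2 : ℤ) - x.2) with hS2
  set S3 := S.filter (fun x => 0 ≤ (c x.1 : ℤ) - x.1 ∧ (c x.1 : ℤ) - x.1 < t) with hS3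
  have hc1 : S1.card = descents t (frobP P) := by
    refine Finset.card_bij (fun x _ => c x.1 - x.1) ?_ ?_ ?_
    · rintro ⟨j, k⟩ hx
      rw [hS1, Finset.mem_filter, hmemS] at hx
      simp only at hx
      simp only [Finset.mem_filter]
      refine ⟨(hmem _).2 ⟨j - 1, ?_⟩, by omega, ?_⟩
      · rw [Nat.sub_add_cancel hx.1.1]
        omega
      · rw [hmem, hnot]
        refine ⟨k - 1, ?_⟩
        rw [Nat.sub_add_cancel hx.1.2.1]
        omega
    · intro x hx y hy h
      rw [hS1, Finset.mem_filter] at hx hy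
      exact hinj x y hx.1 hy.1 (by omega)
    · intro m hm
      simp only [Finset.mem_filter] at hm
      obtain ⟨h1, h2, h3⟩ := hm
      obtain ⟨i, hi⟩ := (hmem m).1 h1
      rw [hmem, hnot] at h3
      obtain ⟨k, hk⟩ := h3
      refine ⟨(i + 1, k + 1), ?_, by simp only; omega⟩
      have := hs i k
      have h6 := hs k i
      rw [hS1, Finset.mem_filter, hmemS]
      dsimp only at h2 hk hi this h6 ⊢
      push_cast
      simp only [true_and]
      omega
  have hc2 : S2.card = S1.card := by
    refine Finset.card_bij' (fun x _ => x.swap) (fun x _ => x.swap) ?_ ?_ (by simp) (by simp)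
    · rintro ⟨j, k⟩ hx
      rw [hS2, Finset.mem_filter, hmemS] at hx
      rw [hS1, Finset.mem_filter, hmemS]
      simp only [Prod.swap] at hx ⊢
      omega
    · rintro ⟨j, k⟩ hx
      rw [hS1, Finset.mem_filter, hmemS] at hx
      rw [hS2, Finset.mem_filter, hmemS]
      simp only [Prod.swap] at hx ⊢
      omega
  have hc3 : S3.card ≤ t := by
    rw [← Finset.card_range t]
    refine Finset.card_le_card_of_injOn (fun x => c x.1 - x.1) ?_ ?_
    · intro x hx
      rw [Finset.mem_coe, hS3, Finset.mem_filter] at hx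
      simp only [Finset.coe_range, Set.mem_Iio]
      omega
    · intro x hx y hy h
      rw [Finset.mem_coe, hS3, Finset.mem_filter] at hx hy
      simp only at h
      exact hinj x y hx.1 hy.1 (by omega)
  have hdisj : Disjoint S1 S2 := by
    rw [Finset.disjoint_filter]
    intro x hx h1 h2
    rw [hmemS] at hx
    omega
  have hNS : Nhook t P = S.card := rfl
  have h12 : (S1 ∪ S2).card = S1.card + S2.card := Finset.card_union_of_disjoint hdisj
  have hsub : S1 ∪ S2 ⊆ S := Finset.union_subset (Finset.filter_subset _ _)
    (Finset.filter_subset _ _)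
  have hsup : S ⊆ (S1 ∪ S2) ∪ S3 := by
    intro x hx
    simp only [Finset.mem_union, hS1, hS2, hS3, Finset.mem_filter, hx, true_and]
    rw [hmemS] at hx
    omega
  have h4 := Finset.card_le_card hsub
  have h5 := (Finset.card_le_card hsup).trans (Finset.card_union_le _ _)
  omega

lemma sum_SC_eq {n N : ℕ} (h : n ≤ N) (F : Finset ℕ → ℝ) :
    ∑ P ∈ SC n, F (frobP P) =
      ∑ E ∈ (Finset.range N).powerset.filter (fun E => ∑ e ∈ E, (2 * e + 1) = n), F E := by
  refine Finset.sum_nbij frobP ?_ (frobP_injOn n) ?_ (fun _ _ => rfl)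
  · intro P hP
    have hP' : IsSelfConjugate P := by simpa [SC] using hP
    rw [Finset.mem_filter, Finset.mem_powerset]
    refine ⟨?_, sum_frobP hP'⟩
    exact (Finset.filter_subset _ _).trans (Finset.range_mono h)
  · intro E hE
    rw [Finset.mem_coe, Finset.mem_filter] at hE
    obtain ⟨P, hP, hPE⟩ := exists_frobP_eq hE.2
    exact ⟨P, hP, hPE⟩

lemma descents_insert_last {t N : ℕ} (ht : 1 ≤ t) {E : Finset ℕ} (hE : E ⊆ Finset.range N) :
    descents t (insert N E) = descents t E + if t ≤ N ∧ N - t ∉ E then 1 else 0 := by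
  have hN : N ∉ E := fun h => by simpa using hE h
  have h1 : (insert N E).filter (fun m => t ≤ m ∧ m - t ∉ insert N E) =
      if t ≤ N ∧ N - t ∉ E then insert N (E.filter (fun m => t ≤ m ∧ m - t ∉ E))
      else E.filter (fun m => t ≤ m ∧ m - t ∉ E) := by
    have hlt : ∀ m ∈ E, m < N := fun m hm => by simpa using hE hm
    split_ifs with h
    · ext m
      simp only [Finset.mem_filter, Finset.mem_insert, not_or]
      constructor
      · rintro ⟨h | h, h2, h3, h4⟩
        · exact Or.inl h
        · exact Or.inr ⟨h, h2, h4⟩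
      · rintro (rfl | ⟨h2, h3, h4⟩)
        · exact ⟨Or.inl rfl, h.1, by omega, h.2⟩
        · have := hlt m h2
          exact ⟨Or.inr h2, h3, by omega, h4⟩
    · ext m
      simp only [Finset.mem_filter, Finset.mem_insert, not_or]
      constructor
      · rintro ⟨rfl | h', h2, h3, h4⟩
        · exact absurd ⟨h2, h4⟩ h
        · exact ⟨h', h2, h4⟩
      · rintro ⟨h2, h3, h4⟩
        have := hlt m h2
        exact ⟨Or.inr h2, h3, by omega, h4⟩
  rw [descents, h1, descents]
  split_ifs with h
  · rw [Finset.card_insert_of_notMem (by simp [hN])]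
  · rfl

/-- The weight `T ^ descents * ∏ y` of a finite set of naturals. -/
noncomputable def wt (t : ℕ) (T : ℂ) (y : ℕ → ℂ) (E : Finset ℕ) : ℂ :=
  T ^ descents t E * ∏ m ∈ E, y m

/-- The partition function over subsets of `range N`. -/
noncomputable def partFun (t : ℕ) (T : ℂ) (y : ℕ → ℂ) (N : ℕ) : ℂ :=
  ∑ E ∈ (Finset.range N).powerset, wt t T y E

/-- The transfer coefficients: `0` for `m < t`, then `c (m + t) = 1 / (1 + y m (1 + (T - 1) c m))`. -/
noncomputable def transferC (t : ℕ) (T : ℂ) (y : ℕ → ℂ) (m : ℕ) : ℂ :=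
  if h : 1 ≤ t ∧ t ≤ m then 1 / (1 + y (m - t) * (1 + (T - 1) * transferC t T y (m - t))) else 0
termination_by m

lemma transferC_of_lt {t m : ℕ} (T : ℂ) (y : ℕ → ℂ) (h : m < t) : transferC t T y m = 0 := by
  rw [transferC, dif_neg (by omega)]

lemma transferC_add {t : ℕ} (ht : 1 ≤ t) (T : ℂ) (y : ℕ → ℂ) (m : ℕ) :
    transferC t T y (m + t) = 1 / (1 + y m * (1 + (T - 1) * transferC t T y m)) := by
  rw [transferC, dif_pos (by omega), Nat.add_sub_cancel]

/-- The successive ratios of the partition function. -/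
noncomputable def transferR (t : ℕ) (T : ℂ) (y : ℕ → ℂ) (m : ℕ) : ℂ :=
  1 + y m * (1 + (T - 1) * transferC t T y m)

lemma wt_insert_last {t N : ℕ} (ht : 1 ≤ t) (T : ℂ) (y : ℕ → ℂ) {E : Finset ℕ}
    (hE : E ⊆ Finset.range N) :
    wt t T y (insert N E) =
      wt t T y E * (y N * (1 + (T - 1) * if t ≤ N ∧ N - t ∉ E then 1 else 0)) := by
  have hN : N ∉ E := fun h => by simpa using hE h
  rw [wt, wt, descents_insert_last ht hE, Finset.prod_insert hN]
  split_ifs <;> ring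

lemma sum_wt_disjoint {t : ℕ} (ht : 1 ≤ t) (T : ℂ) (y : ℕ → ℂ) (N : ℕ)
    (hR : ∀ m < N, transferR t T y m ≠ 0) (J : Finset ℕ) (hJ : ∀ m ∈ J, m < N ∧ N ≤ m + t) :
    ∑ E ∈ (Finset.range N).powerset, wt t T y E * (if Disjoint E J then 1 else 0) =
      (∏ m ∈ Finset.range N, transferR t T y m) * ∏ m ∈ J, transferC t T y (m + t) := by
  induction N generalizing J with
  | zero =>
    have : J = ∅ := by
      refine Finset.eq_empty_of_forall_notMem fun m hm => ?_
      have := hJ m hm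
      omega
    subst this
    simp [wt, descents]
  | succ N ih =>
    have hR' : ∀ m < N, transferR t T y m ≠ 0 := fun m hm => hR m (by omega)
    have ih' := ih hR'
    rw [Finset.range_add_one, Finset.sum_powerset_insert Finset.notMem_range_self,
      Finset.prod_insert Finset.notMem_range_self]
    by_cases hNJ : N ∈ J
    · have h1 := ih' (J.erase N) (fun m hm => by
        have h1 := hJ m (Finset.mem_of_mem_erase hm)
        have h2 := Finset.ne_of_mem_erase hm
        omega)
      have h2 : ∑ E ∈ (Finset.range N).powerset, wt t T y E * (if Disjoint E J then 1 else 0) =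
          ∑ E ∈ (Finset.range N).powerset,
            wt t T y E * (if Disjoint E (J.erase N) then 1 else 0) := by
        refine Finset.sum_congr rfl fun E hE => ?_
        have hE' := Finset.mem_powerset.1 hE
        have hN : N ∉ E := fun h => by simpa using hE' h
        congr 1
        refine if_congr ?_ rfl rfl
        conv_rhs => rw [← Finset.disjoint_erase_comm, Finset.erase_eq_of_notMem hN]
      have h3 : ∑ E ∈ (Finset.range N).powerset,
          wt t T y (insert N E) * (if Disjoint (insert N E) J then 1 else 0) = 0 := by
        refine Finset.sum_eq_zero fun E _ => ?_
        rw [if_neg, mul_zero]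
        simp [Finset.disjoint_insert_left, hNJ]
      rw [h2, h3, h1, ← Finset.mul_prod_erase J _ hNJ, transferC_add ht]
      have := hR N (by omega)
      rw [transferR] at this
      rw [transferR]
      field_simp
      ring
    · have h0 := ih' J (fun m hm => by
        have h1 := hJ m hm
        have : m ≠ N := fun h => hNJ (h ▸ hm)
        omega)
      have h3 : ∑ E ∈ (Finset.range N).powerset,
          wt t T y (insert N E) * (if Disjoint (insert N E) J then 1 else 0) =
          y N * (∑ E ∈ (Finset.range N).powerset,
            wt t T y E * (if Disjoint E J then 1 else 0)) + y N * (T - 1) *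
            ∑ E ∈ (Finset.range N).powerset, wt t T y E * (if Disjoint E J then 1 else 0) *
              (if t ≤ N ∧ N - t ∉ E then 1 else 0) := by
        rw [Finset.mul_sum, Finset.mul_sum, ← Finset.sum_add_distrib]
        refine Finset.sum_congr rfl fun E hE => ?_
        have hE' := Finset.mem_powerset.1 hE
        rw [wt_insert_last ht T y hE']
        simp only [Finset.disjoint_insert_left, hNJ, not_false_eq_true, true_and]
        ring
      have h4 : ∑ E ∈ (Finset.range N).powerset, wt t T y E * (if Disjoint E J then 1 else 0) *
              (if t ≤ N ∧ N - t ∉ E then 1 else 0) =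
          (∏ m ∈ Finset.range N, transferR t T y m) * (∏ m ∈ J, transferC t T y (m + t)) *
            transferC t T y N := by
        rcases lt_or_ge N t with hNt | hNt
        · rw [transferC_of_lt T y hNt, mul_zero]
          refine Finset.sum_eq_zero fun E _ => ?_
          rw [if_neg (c := t ≤ N ∧ N - t ∉ E) (fun h => by omega), mul_zero]
        · have hnJ : N - t ∉ J := fun h => by
            have := hJ _ h
            omega
          have h1 := ih' (insert (N - t) J) (fun m hm => by
            rcases Finset.mem_insert.1 hm with rfl | hm
            · omega
            · have h1 := hJ m hm
              have : m ≠ N := fun h => hNJ (h ▸ hm)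
              omega)
          rw [Finset.prod_insert hnJ, Nat.sub_add_cancel hNt] at h1
          rw [mul_assoc, mul_comm (∏ m ∈ J, _), ← h1]
          refine Finset.sum_congr rfl fun E _ => ?_
          rw [mul_assoc]
          congr 1
          simp only [Finset.disjoint_insert_right, hNt, true_and]
          by_cases ha : N - t ∈ E <;> by_cases hb : Disjoint E J <;> simp [ha, hb]
      rw [h3, h4, h0, transferR]
      ring

lemma partFun_eq_prod {t : ℕ} (ht : 1 ≤ t) (T : ℂ) (y : ℕ → ℂ) (N : ℕ)
    (hR : ∀ m < N, transferR t T y m ≠ 0) :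
    partFun t T y N = ∏ m ∈ Finset.range N, transferR t T y m := by
  simpa [partFun] using sum_wt_disjoint ht T y N hR ∅ (by simp)

/-- The change in the number of descents when `a` is inserted. -/
noncomputable def descChange (t a : ℕ) (F : Finset ℕ) : ℤ :=
  (if t ≤ a ∧ a - t ∉ F then 1 else 0) - if a + t ∈ F then 1 else 0

lemma descChange_bounds (t a : ℕ) (F : Finset ℕ) :
    descChange t a F = -1 ∨ descChange t a F = 0 ∨ descChange t a F = 1 := by
  rw [descChange]
  split_ifs <;> simp

lemma descents_insert {t a : ℕ} (ht : 1 ≤ t) {F : Finset ℕ} (ha : a ∉ F) :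
    (descents t (insert a F) : ℤ) = descents t F + descChange t a F := by
  have h1 : ∀ m ∈ F, (if t ≤ m ∧ m - t ∉ insert a F then (1 : ℤ) else 0) =
      (if t ≤ m ∧ m - t ∉ F then 1 else 0) - if m = a + t then 1 else 0 := by
    intro m _
    rcases eq_or_ne m (a + t) with rfl | h
    · simp [ha]
    · by_cases htm : t ≤ m
      · have : m - t ≠ a := by omega
        simp [htm, h, this]
      · simp [htm, h]
  have h2 : ¬ (a - t = a ∧ t ≤ a) := by omega
  rw [descents, descents, Finset.card_filter, Finset.card_filter, Finset.sum_insert ha]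
  push_cast
  rw [Finset.sum_congr rfl h1, Finset.sum_sub_distrib, Finset.sum_ite_eq', descChange]
  have h3 : (t ≤ a ∧ a - t ∉ insert a F) ↔ (t ≤ a ∧ a - t ∉ F) := by
    simp only [Finset.mem_insert, not_or]
    constructor
    · rintro ⟨h, -, h'⟩
      exact ⟨h, h'⟩
    · rintro ⟨h, h'⟩
      exact ⟨h, fun h'' => h2 ⟨h'', h⟩, h'⟩
  rw [if_congr h3 rfl rfl]
  ring

lemma wt_insert {t a : ℕ} (ht : 1 ≤ t) {T : ℂ} (hT : T ≠ 0) (y : ℕ → ℂ) {F : Finset ℕ}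
    (ha : a ∉ F) : wt t T y (insert a F) = wt t T y F * (y a * T ^ descChange t a F) := by
  rw [wt, wt, Finset.prod_insert ha, ← zpow_natCast T (descents t (insert a F)),
    descents_insert ht ha, zpow_add₀ hT, zpow_natCast]
  ring

lemma descChange_insert {t a m : ℕ} {F : Finset ℕ} (h1 : m + t ≠ a) (h2 : a + t ≠ m) :
    descChange t m (insert a F) = descChange t m F := by
  rw [descChange, descChange]
  by_cases h : t ≤ m
  · have : m - t ≠ a := by omega
    simp [this, h1]
  · simp [h, h1]

lemma partFun_eq_sum_sdiff {t : ℕ} (ht : 1 ≤ t) {T : ℂ} (hT : T ≠ 0) (y : ℕ → ℂ) (N : ℕ)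
    {S : Finset ℕ} (hSN : S ⊆ Finset.range N) (hS : ∀ m ∈ S, m + t ∉ S) :
    partFun t T y N = ∑ F ∈ (Finset.range N \ S).powerset,
      wt t T y F * ∏ m ∈ S, (1 + y m * T ^ descChange t m F) := by
  induction S using Finset.induction_on with
  | empty => simp [partFun]
  | insert a S haS ih =>
    rw [ih ((Finset.subset_insert a S).trans hSN)
      (fun m hm h => hS m (Finset.mem_insert_of_mem hm) (Finset.mem_insert_of_mem h))]
    have h1 : Finset.range N \ S = insert a (Finset.range N \ insert a S) := by
      ext m
      have : a < N := by simpa using hSN (Finset.mem_insert_self a S)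
      simp only [Finset.mem_sdiff, Finset.mem_range, Finset.mem_insert]
      by_cases h : m = a
      · subst h
        simp [haS, this]
      · simp [h]
    have h2 : a ∉ Finset.range N \ insert a S := by simp
    rw [h1, Finset.sum_powerset_insert h2, ← Finset.sum_add_distrib]
    refine Finset.sum_congr rfl fun F hF => ?_
    have haF : a ∉ F := fun h => h2 (Finset.mem_powerset.1 hF h)
    rw [Finset.prod_insert haS, wt_insert ht hT y haF]
    have h3 : ∏ m ∈ S, (1 + y m * T ^ descChange t m (insert a F)) =
        ∏ m ∈ S, (1 + y m * T ^ descChange t m F) := by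
      refine Finset.prod_congr rfl fun m hm => ?_
      rw [descChange_insert]
      · intro h
        exact hS m (Finset.mem_insert_of_mem hm) (h ▸ Finset.mem_insert_self _ _)
      · intro h
        exact hS a (Finset.mem_insert_self _ _) (h ▸ Finset.mem_insert_of_mem hm)
    rw [h3]
    ring

lemma norm_partFun_le {t : ℕ} (ht : 1 ≤ t) {T : ℝ} (hT : 0 < T) (y : ℕ → ℂ) (N : ℕ)
    {S : Finset ℕ} (hSN : S ⊆ Finset.range N) (hS : ∀ m ∈ S, m + t ∉ S) (η : ℕ → ℝ)
    (hη : ∀ m ∈ S, ∀ b : ℤ, (b = -1 ∨ b = 0 ∨ b = 1) →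
      ‖1 + y m * (T : ℂ) ^ b‖ ≤ (1 + ‖y m‖ * T ^ b) * Real.exp (-η m)) :
    ‖partFun t T y N‖ ≤
      Real.exp (-∑ m ∈ S, η m) * ‖partFun t T (fun m => (‖y m‖ : ℂ)) N‖ := by
  have hT' : (T : ℂ) ≠ 0 := by exact_mod_cast hT.ne'
  have h1 : partFun t T (fun m => (‖y m‖ : ℂ)) N =
      ((∑ F ∈ (Finset.range N \ S).powerset,
        (T ^ descents t F * ∏ m ∈ F, ‖y m‖) * ∏ m ∈ S, (1 + ‖y m‖ * T ^ descChange t m F) : ℝ) :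
        ℂ) := by
    rw [partFun_eq_sum_sdiff ht hT' _ N hSN hS]
    simp only [wt]
    push_cast
    rfl
  rw [h1, Complex.norm_real, Real.norm_of_nonneg (Finset.sum_nonneg fun F _ => by positivity),
    partFun_eq_sum_sdiff ht hT' _ N hSN hS, Finset.mul_sum]
  refine (norm_sum_le _ _).trans (Finset.sum_le_sum fun F _ => ?_)
  rw [norm_mul, norm_prod, wt, norm_mul, norm_prod, norm_pow, Complex.norm_real,
    Real.norm_of_nonneg hT.le]
  have h2 : ∏ m ∈ S, ‖1 + y m * (T : ℂ) ^ descChange t m F‖ ≤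
      ∏ m ∈ S, (1 + ‖y m‖ * T ^ descChange t m F) * Real.exp (-η m) :=
    Finset.prod_le_prod (fun m _ => norm_nonneg _)
      fun m hm => hη m hm _ (descChange_bounds t m F)
  rw [Finset.prod_mul_distrib, ← Real.exp_sum, Finset.sum_neg_distrib] at h2
  calc _ ≤ (T ^ descents t F * ∏ m ∈ F, ‖y m‖) *
        ((∏ m ∈ S, (1 + ‖y m‖ * T ^ descChange t m F)) * Real.exp (-∑ m ∈ S, η m)) := by
        gcongr
    _ = _ := by ring

lemma norm_one_add_mul_exp_le {X : ℝ} (hX : 0 ≤ X) (φ : ℝ) {κ : ℝ}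
    (hκ : κ * (1 + X) ^ 2 ≤ X) :
    ‖1 + (X : ℂ) * cexp (φ * I)‖ ≤ (1 + X) * Real.exp (-(κ * (1 - Real.cos φ))) := by
  have h1 : ‖1 + (X : ℂ) * cexp (φ * I)‖ ^ 2 = (1 + X) ^ 2 - 2 * X * (1 - Real.cos φ) := by
    rw [← Complex.normSq_eq_norm_sq, Complex.exp_mul_I, ← Complex.ofReal_cos,
      ← Complex.ofReal_sin]
    simp only [Complex.normSq_apply, add_re, one_re, mul_re, ofReal_re, ofReal_im, I_re, I_im,
      add_im, one_im, mul_im]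
    nlinarith [Real.sin_sq_add_cos_sq φ]
  refine le_of_sq_le_sq ?_ (by positivity)
  rw [h1, mul_pow, ← Real.exp_nat_mul]
  have h2 := Real.add_one_le_exp (((2 : ℕ) : ℝ) * -(κ * (1 - Real.cos φ)))
  have h3 : 0 ≤ 1 - Real.cos φ := by linarith [Real.cos_le_one φ]
  calc _ ≤ (1 + X) ^ 2 - 2 * (κ * (1 + X) ^ 2) * (1 - Real.cos φ) := by nlinarith
    _ = (1 + X) ^ 2 * (((2 : ℕ) : ℝ) * -(κ * (1 - Real.cos φ)) + 1) := by push_cast; ring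
    _ ≤ _ := by gcongr

lemma two_sin_mul_sum_cos (θ : ℝ) (L : ℕ) :
    2 * Real.sin θ * ∑ m ∈ Finset.range L, Real.cos ((2 * m + 1) * θ) = Real.sin (2 * L * θ) := by
  induction L with
  | zero => simp
  | succ L ih =>
    rw [Finset.sum_range_succ, mul_add, ih]
    have h1 : (2 * ((L + 1 : ℕ) : ℝ) * θ) = (2 * L + 1) * θ + θ := by push_cast; ring
    have h2 : 2 * (L : ℝ) * θ = (2 * L + 1) * θ - θ := by ring
    rw [h1, h2, Real.sin_add, Real.sin_sub]
    ring

lemma cube_le_sum_odd_sq (L : ℕ) :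
    (L : ℝ) ^ 3 ≤ ∑ m ∈ Finset.range L, (2 * (m : ℝ) + 1) ^ 2 := by
  induction L with
  | zero => simp
  | succ L ih =>
    rw [Finset.sum_range_succ]
    push_cast
    have : (0 : ℝ) ≤ L := L.cast_nonneg
    nlinarith

lemma sum_one_sub_cos_lower_of_nonneg {θ : ℝ} (h0 : 0 ≤ θ) (hθ : θ ≤ π) {L : ℕ} (hL : 1 ≤ L) :
    min ((L : ℝ) / 2) (θ ^ 2 * L ^ 3 / 5) ≤
      ∑ m ∈ Finset.range L, (1 - Real.cos ((2 * m + 1) * θ)) := by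
  have hL' : (1 : ℝ) ≤ L := by exact_mod_cast hL
  have hs0 : 0 ≤ Real.sin θ := Real.sin_nonneg_of_nonneg_of_le_pi h0 hθ
  have hsum := two_sin_mul_sum_cos θ L
  rcases le_or_gt 1 (L * Real.sin θ) with h | h
  · refine (min_le_left _ _).trans ?_
    rw [Finset.sum_sub_distrib]
    simp only [Finset.sum_const, Finset.card_range, nsmul_eq_mul, mul_one]
    have hs : 0 < Real.sin θ := by
      by_contra hc
      nlinarith
    have h1 := Real.sin_le_one (2 * L * θ)
    rw [← hsum] at h1
    have h2 : ∑ m ∈ Finset.range L, Real.cos ((2 * m + 1) * θ) ≤ L / 2 := by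
      by_contra hc
      push Not at hc
      nlinarith
    linarith
  · rcases le_or_gt θ (π / 2) with h2 | h2
    · refine (min_le_right _ _).trans ?_
      have h3 := Real.mul_le_sin h0 h2
      have h4 : 2 * L * θ ≤ π := by
        have : 2 / π * θ * L < 1 := by nlinarith
        have hp := Real.pi_pos
        rw [div_mul_eq_mul_div, div_mul_eq_mul_div, div_lt_one hp] at this
        linarith
      have h5 : ∀ m ∈ Finset.range L,
          θ ^ 2 / 5 * (2 * (m : ℝ) + 1) ^ 2 ≤ 1 - Real.cos ((2 * m + 1) * θ) := by
        intro m hm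
        have hm' : (m : ℝ) + 1 ≤ L := by exact_mod_cast Finset.mem_range.1 hm
        have h6 : |(2 * (m : ℝ) + 1) * θ| ≤ π := by
          rw [abs_of_nonneg (by positivity)]
          nlinarith
        have h7 := Real.cos_le_one_sub_mul_cos_sq h6
        have h8 : (1 : ℝ) / 5 ≤ 2 / π ^ 2 := by
          rw [div_le_div_iff₀ (by norm_num) (by positivity)]
          nlinarith [Real.pi_lt_d2, Real.pi_pos]
        have h9 : 0 ≤ ((2 * (m : ℝ) + 1) * θ) ^ 2 := by positivity
        nlinarith
      refine le_trans ?_ (Finset.sum_le_sum h5)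
      rw [← Finset.mul_sum]
      have := cube_le_sum_odd_sq L
      have h9 : 0 ≤ θ ^ 2 / 5 := by positivity
      nlinarith
    · refine (min_le_left _ _).trans ?_
      suffices hneg : ∑ m ∈ Finset.range L, Real.cos ((2 * m + 1) * θ) ≤ 0 by
        rw [Finset.sum_sub_distrib]
        simp only [Finset.sum_const, Finset.card_range, nsmul_eq_mul, mul_one]
        linarith
      rcases hθ.eq_or_lt with rfl | hlt
      · refine Finset.sum_nonpos fun m _ => ?_
        rw [add_mul, one_mul, Real.cos_add_pi]
        have : Real.cos (2 * m * π) = 1 := by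
          rw [show 2 * (m : ℝ) * π = m * (2 * π) by ring, Real.cos_nat_mul_two_pi]
        rw [this]
        norm_num
      · have hs : 0 < Real.sin θ := Real.sin_pos_of_pos_of_lt_pi (by linarith [Real.pi_pos]) hlt
        have h3 := Real.mul_le_sin (x := π - θ) (by linarith) (by linarith)
        rw [Real.sin_pi_sub] at h3
        have h4 : 2 * L * (π - θ) ≤ π := by
          have : 2 / π * (π - θ) * L < 1 := by nlinarith
          have hp := Real.pi_pos
          rw [div_mul_eq_mul_div, div_mul_eq_mul_div, div_lt_one hp] at this
          linarith
        have h5 : Real.sin (2 * L * θ) = - Real.sin (2 * L * (π - θ)) := by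
          rw [show 2 * (L : ℝ) * (π - θ) = L * (2 * π) - 2 * L * θ by ring,
            Real.sin_nat_mul_two_pi_sub, neg_neg]
        have h6 : 0 ≤ Real.sin (2 * L * (π - θ)) :=
          Real.sin_nonneg_of_nonneg_of_le_pi
            (mul_nonneg (by positivity) (by linarith)) h4
        by_contra hc
        push Not at hc
        nlinarith [mul_pos hs hc]

lemma sum_one_sub_cos_lower {θ : ℝ} (hθ : |θ| ≤ π) {L : ℕ} (hL : 1 ≤ L) :
    min ((L : ℝ) / 2) (θ ^ 2 * L ^ 3 / 5) ≤
      ∑ m ∈ Finset.range L, (1 - Real.cos ((2 * m + 1) * θ)) := by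
  have h := sum_one_sub_cos_lower_of_nonneg (abs_nonneg θ) hθ hL
  rw [sq_abs] at h
  refine h.trans_eq (Finset.sum_congr rfl fun m _ => ?_)
  have : (2 * (m : ℝ) + 1) * |θ| = |(2 * m + 1) * θ| := by
    rw [abs_mul, abs_of_nonneg (by positivity : (0 : ℝ) ≤ 2 * m + 1)]
  rw [this, Real.cos_abs]

lemma fiftieth_mul_sq_le {v : ℝ} (hv : |v| ≤ 3) :
    1 / 50 * (1 + Real.exp v) ^ 2 ≤ Real.exp v := by
  have h3 : Real.exp 3 ≤ 21 := by
    have : Real.exp 3 = Real.exp 1 ^ 3 := by rw [← Real.exp_nat_mul]; norm_num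
    rw [this]
    calc Real.exp 1 ^ 3 ≤ 2.7182818286 ^ 3 := by
          gcongr
          exact Real.exp_one_lt_d9.le
      _ ≤ 21 := by norm_num
  have h1 : Real.exp v ≤ 21 := (Real.exp_le_exp.2 (abs_le.1 hv).2).trans h3
  have h2 : Real.exp (-v) ≤ 21 :=
    (Real.exp_le_exp.2 (by linarith [(abs_le.1 hv).1])).trans h3
  have h4 : Real.exp v * Real.exp (-v) = 1 := by rw [← Real.exp_add]; simp
  have h5 := Real.exp_pos v
  nlinarith

/-- The Boltzmann weights `e^{(-β + iθ)(2m+1)}`. -/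
noncomputable def bw (β θ : ℝ) (m : ℕ) : ℂ := cexp ((-β + θ * I) * (2 * m + 1))

lemma norm_bw (β θ : ℝ) (m : ℕ) : ‖bw β θ m‖ = Real.exp (-β * (2 * m + 1)) := by
  rw [bw, Complex.norm_exp]
  congr 1
  simp

lemma norm_bw_eq (β θ : ℝ) : (fun m => (‖bw β θ m‖ : ℂ)) = bw β 0 := by
  funext m
  rw [norm_bw, bw]
  push_cast
  simp

lemma norm_partFun_bw_le {t : ℕ} (ht : 1 ≤ t) {β lam θ : ℝ} (hβ : 0 < β)
    (hlam : |lam| ≤ 1) (hθ : |θ| ≤ π) {L N : ℕ} (hL : 1 ≤ L) (hLN : L ≤ N)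
    (hβL : β * L ≤ 1) :
    ‖partFun t (Real.exp lam : ℝ) (bw β θ) N‖ ≤
      Real.exp (-(1 / 100 * min ((L : ℝ) / 2) (θ ^ 2 * L ^ 3 / 5))) *
        ‖partFun t (Real.exp lam : ℝ) (bw β 0) N‖ := by
  set Z := ‖partFun t (Real.exp lam : ℝ) (bw β θ) N‖ with hZ
  set Z0 := ‖partFun t (Real.exp lam : ℝ) (bw β 0) N‖ with hZ0
  set S : ℕ → Finset ℕ := fun i => (Finset.range L).filter (fun m => (m / t) % 2 = i) with hS
  set η : ℕ → ℝ := fun m => 1 / 50 * (1 - Real.cos ((2 * m + 1) * θ)) with hη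
  have key : ∀ i, Z ≤ Real.exp (-∑ m ∈ S i, η m) * Z0 := by
    intro i
    rw [hZ, hZ0, ← norm_bw_eq β θ]
    refine norm_partFun_le ht (Real.exp_pos lam) _ N ?_ ?_ η ?_
    · exact (Finset.filter_subset _ _).trans (Finset.range_mono hLN)
    · intro m hm hm'
      rw [hS, Finset.mem_filter] at hm hm'
      have := Nat.add_div_right m (show 0 < t by omega)
      omega
    · intro m hm b hb
      have hmL : (m : ℝ) + 1 ≤ L := by
        have := Finset.mem_range.1 (Finset.mem_filter.1 hm).1
        exact_mod_cast this
      have hm0 : (0 : ℝ) ≤ m := m.cast_nonneg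
      have hb' : |(b : ℝ) * lam| ≤ 1 := by
        rcases hb with rfl | rfl | rfl <;> simp [hlam]
      have hX : ‖bw β θ m‖ * Real.exp lam ^ b = Real.exp (-β * (2 * m + 1) + b * lam) := by
        rw [norm_bw, Real.exp_add]
        congr 1
        rcases hb with rfl | rfl | rfl <;> simp [Real.exp_neg]
      have hY : bw β θ m * ((Real.exp lam : ℝ) : ℂ) ^ b =
          ((Real.exp (-β * (2 * m + 1) + b * lam) : ℝ) : ℂ) *
            cexp (((2 * m + 1) * θ : ℝ) * I) := by
        rw [bw, Complex.ofReal_exp, Complex.ofReal_exp, ← Complex.exp_int_mul, ← Complex.exp_add,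
          ← Complex.exp_add]
        congr 1
        push_cast
        ring
      rw [hX, hY]
      refine norm_one_add_mul_exp_le (Real.exp_pos _).le _ (fiftieth_mul_sq_le ?_)
      have h1 : 0 ≤ β * (2 * m + 1) := by positivity
      have h2 : β * (2 * m + 1) ≤ 2 := by nlinarith
      rw [abs_le] at hb' ⊢
      constructor <;> nlinarith
  have hsum : ∑ m ∈ S 0, η m + ∑ m ∈ S 1, η m =
      1 / 50 * ∑ m ∈ Finset.range L, (1 - Real.cos ((2 * m + 1) * θ)) := by
    rw [Finset.mul_sum, ← Finset.sum_filter_add_sum_filter_not (Finset.range L)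
      (fun m => (m / t) % 2 = 0)]
    congr 1
    refine Finset.sum_congr ?_ fun _ _ => rfl
    ext m
    simp only [hS, Finset.mem_filter]
    have := Nat.mod_two_eq_zero_or_one (m / t)
    rcases this with h | h <;> simp [h]
  have h0 := key 0
  have h1 := key 1
  have hZ0' : 0 ≤ Z0 := norm_nonneg _
  have hZ' : 0 ≤ Z := norm_nonneg _
  have h2 : Z ≤ Real.exp (-((∑ m ∈ S 0, η m + ∑ m ∈ S 1, η m) / 2)) * Z0 := by
    refine le_of_sq_le_sq ?_ (by positivity)
    calc Z ^ 2 = Z * Z := sq Z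
      _ ≤ (Real.exp (-∑ m ∈ S 0, η m) * Z0) * (Real.exp (-∑ m ∈ S 1, η m) * Z0) :=
          mul_le_mul h0 h1 hZ' (by positivity)
      _ = _ := by
          rw [mul_pow, ← Real.exp_nat_mul]
          rw [show ((2 : ℕ) : ℝ) * -((∑ m ∈ S 0, η m + ∑ m ∈ S 1, η m) / 2) =
            -∑ m ∈ S 0, η m + -∑ m ∈ S 1, η m by push_cast; ring, Real.exp_add]
          ring
  refine h2.trans ?_
  have h3 := sum_one_sub_cos_lower hθ hL
  gcongr
  rw [hsum]
  linarith

/-- The second-order expansion of the deviation `δ` in the small parameter `τ`. -/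
lemma isBigO_deviation_expansion {X : Type*} {L : Filter X} {σ : X → X} (hσ : Tendsto σ L L)
    {p s ζ w c δ τ e : X → ℂ} (A U : ℂ)
    (hτ : τ =O[L] (fun _ => (1 : ℂ))) (he : e =O[L] (fun _ => (1 : ℂ)))
    (hp : ∀ k ≤ 3, (fun x => p x * s x ^ k) =O[L] e)
    (z1 : (fun x => ζ x - 1) =O[L] fun x => τ x * s x)
    (z2 : (fun x => ζ x - 1 - U * τ x * s x) =O[L] fun x => (τ x * s x) ^ 2)
    (z3 : (fun x => ζ x - 1 - U * τ x * s x - (U * τ x * s x) ^ 2 / 2) =O[L]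
      fun x => (τ x * s x) ^ 3)
    (w1 : w =O[L] τ) (w2 : (fun x => w x - A * τ x) =O[L] fun x => τ x ^ 2)
    (w3 : (fun x => w x - A * τ x - (A * τ x) ^ 2 / 2) =O[L] fun x => τ x ^ 3)
    (hc : c =O[L] fun _ => (1 : ℂ))
    (hδ : ∀ x, δ x = p x * ((ζ x - 1) + ζ x * w x * c x))
    (hrec : ∀ᶠ x in L, c (σ x) * (1 + δ x) = 1 - p x)
    (lagp : (fun x => p (σ x) - p x) =O[L] fun x => τ x ^ 2 * p x)
    (lags : (fun x => s (σ x) - s x) =O[L] fun x => τ x ^ 2)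
    (hτσ : ∀ x, τ (σ x) = τ x) :
    δ =O[L] (fun x => τ x * e x) ∧
    (fun x => δ (σ (σ x)) - δ (σ (σ x)) ^ 2 / 2 -
      (fun y => τ y * (p y * (U * s y + A * (1 - p y))) +
        τ y ^ 2 * (p y * ((U * s y) ^ 2 / 2 + U * s y * A * (1 - p y) + A ^ 2 * (1 - p y) / 2)
          - p y * A * ((1 - p y) * p y * (U * s y + A * (1 - p y)))
          - (p y * (U * s y + A * (1 - p y))) ^ 2 / 2)) (σ (σ x))) =O[L]
      (fun x => τ x ^ 3 * e (σ (σ x))) := by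
  have one := isBigO_refl (fun _ : X => (1 : ℂ)) L
  have rτ := isBigO_refl τ L
  have hp0 : p =O[L] e := (hp 0 (by norm_num)).congr_left (fun x => by simp)
  have hp1 : (fun x => p x * s x) =O[L] e := (hp 1 (by norm_num)).congr_left (fun x => by simp)
  have hp2 := hp 2 (by norm_num)
  have hp3 := hp 3 (by norm_num)
  have hp' : p =O[L] fun _ => (1 : ℂ) := hp0.trans he
  have hps' : (fun x => p x * s x) =O[L] fun _ => (1 : ℂ) := hp1.trans he
  have hq : (fun x => 1 - p x) =O[L] fun _ => (1 : ℂ) := one.sub hp'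
  have hcσ : (fun x => c (σ x)) =O[L] fun _ => (1 : ℂ) := hc.comp_tendsto hσ
  have d1 : δ =O[L] fun x => τ x * e x := by
    have a1 : (fun x => p x * (ζ x - 1)) =O[L] fun x => τ x * e x :=
      (((isBigO_refl p L).mul z1).trans ((rτ.mul hp1).congr_left fun x => by ring))
    have a2 : (fun x => (p x * (ζ x - 1)) * (w x * c x)) =O[L] fun x => τ x * e x := by
      have hwc : (fun x => w x * c x) =O[L] fun _ => (1 : ℂ) :=
        ((w1.trans hτ).mul hc).congr_right fun x => by ring
      exact (a1.mul hwc).congr_right fun x => by ring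
    have a3 : (fun x => p x * (w x * c x)) =O[L] fun x => τ x * e x :=
      (hp0.mul (w1.mul hc)).congr_right fun x => by ring
    exact ((a1.add a2).add a3).congr_left fun x => by rw [hδ]; ring
  have τe1 : (fun x => τ x * e x) =O[L] τ := (rτ.mul he).congr_right fun x => by ring
  have d1' : δ =O[L] τ := d1.trans τe1
  have lagq : (fun x => (1 - p x) - (1 - p (σ x))) =O[L] fun x => τ x ^ 2 :=
    (lagp.trans (((isBigO_refl (fun x => τ x ^ 2) L).mul hp').congr_right
      fun x => by ring)).congr_left fun x => by ring
  have ττ : (fun x => τ x ^ 2) =O[L] τ := (rτ.mul hτ).congr (fun x => by ring) fun x => by ring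
  have c1 : (fun x => c (σ x) - (1 - p (σ x))) =O[L] τ := by
    have a1 : (fun x => c (σ x) - (1 - p x)) =O[L] τ := by
      refine ((hcσ.mul d1').neg_left.congr' ?_ (Eventually.of_forall fun x => one_mul _))
      filter_upwards [hrec] with x hx
      rw [← hx]
      ring
    exact (a1.add (lagq.trans ττ)).congr_left fun x => by ring
  have e2 : (fun x => δ x - τ x * (p x * (U * s x + A * c x))) =O[L] fun x => τ x ^ 2 * e x := by
    have a1 : (fun x => p x * (ζ x - 1 - U * τ x * s x)) =O[L] fun x => τ x ^ 2 * e x :=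
      ((isBigO_refl p L).mul z2).trans
        (((isBigO_refl (fun x => τ x ^ 2) L).mul hp2).congr_left fun x => by ring)
    have a2 : (fun x => p x * ((ζ x - 1) * w x * c x)) =O[L] fun x => τ x ^ 2 * e x :=
      ((isBigO_refl p L).mul ((z1.mul w1).mul hc)).trans
        (((isBigO_refl (fun x => τ x ^ 2) L).mul hp1).congr_left fun x => by ring)
    have a3 : (fun x => p x * ((w x - A * τ x) * c x)) =O[L] fun x => τ x ^ 2 * e x :=
      (hp0.mul (w2.mul hc)).congr_right fun x => by ring
    exact ((a1.add a2).add a3).congr_left fun x => by rw [hδ]; ring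
  have e2σ : (fun x => δ (σ x) - τ x * (p (σ x) * (U * s (σ x) + A * (1 - p (σ x))))) =O[L]
      fun x => τ x ^ 2 * e (σ x) := by
    have a1 := e2.comp_tendsto hσ
    have a2 : (fun x => τ x * A * (p (σ x) * (c (σ x) - (1 - p (σ x))))) =O[L]
        fun x => τ x ^ 2 * e (σ x) :=
      ((rτ.const_mul_left A).mul ((hp0.comp_tendsto hσ).mul c1)).congr
        (fun x => by simp only [Function.comp]; ring) fun x => by
          simp only [Function.comp]; ring
    refine (a1.congr_right fun x => ?_).add a2 |>.congr_left fun x => ?_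
    · simp only [Function.comp, hτσ]
    · simp only [Function.comp, hτσ]; ring
  have heσ : (fun x => e (σ x)) =O[L] fun _ => (1 : ℂ) := he.comp_tendsto hσ
  have hqσ : (fun x => 1 - p (σ x)) =O[L] fun _ => (1 : ℂ) := hq.comp_tendsto hσ
  have hqσσ : (fun x => 1 - p (σ (σ x))) =O[L] fun _ => (1 : ℂ) := hqσ.comp_tendsto hσ
  have rτ2 := isBigO_refl (fun x => τ x ^ 2) L
  have hcσσ : (fun x => c (σ (σ x))) =O[L] fun _ => (1 : ℂ) := hcσ.comp_tendsto hσ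
  have lagg : (fun x => (1 - p x) * p x * (U * s x + A * (1 - p x)) -
      (1 - p (σ x)) * p (σ x) * (U * s (σ x) + A * (1 - p (σ x)))) =O[L]
        fun x => τ x ^ 2 := by
    have hp'σ : (fun x => p (σ x)) =O[L] fun _ => (1 : ℂ) := hp'.comp_tendsto hσ
    have lagp' : (fun x => p (σ x) - p x) =O[L] fun x => τ x ^ 2 :=
      lagp.trans ((rτ2.mul hp').congr_right fun x => by ring)
    have lagps : (fun x => p x * s x - p (σ x) * s (σ x)) =O[L] fun x => τ x ^ 2 := by
      have b1 : (fun x => (p (σ x) - p x) * s x) =O[L] fun x => τ x ^ 2 :=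
        (lagp.mul (isBigO_refl s L)).trans
          ((rτ2.mul hps').congr (fun x => by ring) fun x => by ring)
      have b2 : (fun x => p (σ x) * (s (σ x) - s x)) =O[L] fun x => τ x ^ 2 :=
        (hp'σ.mul lags).congr_right fun x => by ring
      exact (b1.add b2).neg_left.congr_left fun x => by ring
    have b3 : (fun x => (1 - p x) * (U * (p x * s x - p (σ x) * s (σ x)))) =O[L]
        fun x => τ x ^ 2 := (hq.mul (lagps.const_mul_left U)).congr_right fun x => by ring
    have b4 : (fun x => ((1 - p x) - (1 - p (σ x))) * (U * (p (σ x) * s (σ x)))) =O[L]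
        fun x => τ x ^ 2 := (lagq.mul ((hps'.comp_tendsto hσ).const_mul_left U)).congr_right
          fun x => by simp
    have b5 : (fun x => A * (((1 - p x) * (1 - p x)) * (p x - p (σ x)))) =O[L]
        fun x => τ x ^ 2 :=
      (((hq.mul hq).mul lagp'.neg_left).const_mul_left A).congr (fun x => by ring)
        fun x => by ring
    have b6 : (fun x => A * (p (σ x) * (((1 - p x) + (1 - p (σ x))) *
        ((1 - p x) - (1 - p (σ x)))))) =O[L] fun x => τ x ^ 2 :=
      ((hp'σ.mul ((hq.add hqσ).mul lagq)).const_mul_left A).congr_right fun x => by ring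
    exact (((b3.add b4).add b5).add b6).congr_left fun x => by ring
  have c2 : (fun x => c (σ (σ x)) - ((1 - p (σ (σ x))) - τ x * ((1 - p (σ (σ x))) * p (σ (σ x)) *
      (U * s (σ (σ x)) + A * (1 - p (σ (σ x))))))) =O[L] fun x => τ x ^ 2 := by
    have d1σ := d1'.comp_tendsto hσ
    have a0 : (fun x => c (σ (σ x)) - ((1 - p (σ x)) - τ x * ((1 - p (σ x)) * p (σ x) *
        (U * s (σ x) + A * (1 - p (σ x)))))) =O[L] fun x => τ x ^ 2 := by
      have a1 : (fun x => c (σ (σ x)) * δ (σ x) ^ 2) =O[L] fun x => τ x ^ 2 := by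
        refine (hcσσ.mul (d1σ.mul d1σ)).congr (fun x => ?_) fun x => ?_
        · simp only [Function.comp]; ring
        · simp only [Function.comp, hτσ]; ring
      have a2 : (fun x => (1 - p (σ x)) * (δ (σ x) -
          τ x * (p (σ x) * (U * s (σ x) + A * (1 - p (σ x)))))) =O[L] fun x => τ x ^ 2 :=
        (hqσ.mul e2σ).trans ((rτ2.mul heσ).congr (fun x => by ring) fun x => by ring)
      refine (a1.sub a2).congr' ?_ EventuallyEq.rfl
      filter_upwards [hσ.eventually hrec] with x hx
      linear_combination (δ (σ x) - 1) * hx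
    have a3 : (fun x => (1 - p (σ x)) - (1 - p (σ (σ x)))) =O[L] fun x => τ x ^ 2 :=
      (lagq.comp_tendsto hσ).congr_right fun x => by simp only [Function.comp, hτσ]
    have a4 := (lagg.comp_tendsto hσ).congr_right (g₂ := fun x => τ x ^ 2)
      fun x => by simp only [Function.comp, hτσ]
    have a5 : (fun x => τ x * ((1 - p (σ x)) * p (σ x) * (U * s (σ x) + A * (1 - p (σ x))) -
      (1 - p (σ (σ x))) * p (σ (σ x)) * (U * s (σ (σ x)) + A * (1 - p (σ (σ x)))))) =O[L]
        fun x => τ x ^ 2 :=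
      (hτ.mul a4).congr_right fun x => by ring
    exact ((a0.add a3).sub a5).congr_left fun x => by ring
  have c1σ : (fun x => c (σ (σ x)) - (1 - p (σ (σ x)))) =O[L] τ :=
    (c1.comp_tendsto hσ).congr_right fun x => by simp only [Function.comp, hτσ]
  have e3 : (fun x => δ x - (τ x * (p x * (U * s x + A * c x)) +
      τ x ^ 2 * (p x * ((U * s x) ^ 2 / 2 + U * s x * A * c x + A ^ 2 * c x / 2)))) =O[L]
        fun x => τ x ^ 3 * e x := by
    have rτ3 := isBigO_refl (fun x => τ x ^ 3) L
    have a1 : (fun x => p x * (ζ x - 1 - U * τ x * s x - (U * τ x * s x) ^ 2 / 2)) =O[L]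
        fun x => τ x ^ 3 * e x :=
      ((isBigO_refl p L).mul z3).trans ((rτ3.mul hp3).congr_left fun x => by ring)
    have a2 : (fun x => p x * ((w x - A * τ x - (A * τ x) ^ 2 / 2) * c x)) =O[L]
        fun x => τ x ^ 3 * e x := (hp0.mul (w3.mul hc)).congr_right fun x => by ring
    have a3 : (fun x => p x * ((ζ x - 1 - U * τ x * s x) * w x * c x)) =O[L]
        fun x => τ x ^ 3 * e x :=
      ((isBigO_refl p L).mul ((z2.mul w1).mul hc)).trans
        ((rτ3.mul hp2).congr_left fun x => by ring)
    have a4 : (fun x => U * (τ x * ((p x * s x) * ((w x - A * τ x) * c x)))) =O[L]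
        fun x => τ x ^ 3 * e x :=
      ((rτ.mul (hp1.mul (w2.mul hc))).const_mul_left U).congr_right fun x => by ring
    exact (((a1.add a2).add a3).add a4).congr_left fun x => by rw [hδ]; ring
  refine ⟨d1, ?_⟩
  have hσσ := hσ.comp hσ
  have hp0σσ : (fun x => p (σ (σ x))) =O[L] fun x => e (σ (σ x)) := hp0.comp_tendsto hσσ
  have hp1σσ : (fun x => p (σ (σ x)) * s (σ (σ x))) =O[L] fun x => e (σ (σ x)) :=
    hp1.comp_tendsto hσσ
  have f1 : (fun x => δ (σ (σ x)) - (τ x * (p (σ (σ x)) * (U * s (σ (σ x)) + A * c (σ (σ x)))) +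
      τ x ^ 2 * (p (σ (σ x)) * ((U * s (σ (σ x))) ^ 2 / 2 + U * s (σ (σ x)) * A * c (σ (σ x))
        + A ^ 2 * c (σ (σ x)) / 2)))) =O[L] fun x => τ x ^ 3 * e (σ (σ x)) :=
    (e3.comp_tendsto hσσ).congr (fun x => by simp only [Function.comp, hτσ])
      fun x => by simp only [Function.comp, hτσ]
  have f2 : (fun x => A * (τ x * (p (σ (σ x)) *
      (c (σ (σ x)) - ((1 - p (σ (σ x))) - τ x * ((1 - p (σ (σ x))) * p (σ (σ x)) *
      (U * s (σ (σ x)) + A * (1 - p (σ (σ x)))))))))) =O[L] fun x => τ x ^ 3 * e (σ (σ x)) :=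
    ((rτ.mul (hp0σσ.mul c2)).const_mul_left A).congr_right fun x => by ring
  have f3 : (fun x => τ x ^ 2 * ((p (σ (σ x)) * s (σ (σ x)) * (U * A) +
      p (σ (σ x)) * (A ^ 2 / 2)) * (c (σ (σ x)) - (1 - p (σ (σ x)))))) =O[L]
        fun x => τ x ^ 3 * e (σ (σ x)) := by
    have h : (fun x => p (σ (σ x)) * s (σ (σ x)) * (U * A) + p (σ (σ x)) * (A ^ 2 / 2)) =O[L]
        fun x => e (σ (σ x)) := by
      refine IsBigO.add ?_ ?_
      · exact (hp1σσ.const_mul_left (U * A)).congr_left fun x => by ring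
      · exact (hp0σσ.const_mul_left (A ^ 2 / 2)).congr_left fun x => by ring
    exact (rτ2.mul (h.mul c1σ)).congr_right fun x => by ring
  have f4 : (fun x => δ (σ (σ x)) ^ 2 -
      (τ x * (p (σ (σ x)) * (U * s (σ (σ x)) + A * (1 - p (σ (σ x)))))) ^ 2) =O[L]
      fun x => τ x ^ 3 * e (σ (σ x)) := by
    have g1 : (fun x => δ (σ (σ x)) -
        τ x * (p (σ (σ x)) * (U * s (σ (σ x)) + A * (1 - p (σ (σ x)))))) =O[L]
        fun x => τ x ^ 2 * e (σ (σ x)) :=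
      (e2σ.comp_tendsto hσ).congr (fun x => by simp only [Function.comp, hτσ])
        fun x => by simp only [Function.comp, hτσ]
    have g2 : (fun x => δ (σ (σ x))) =O[L] τ :=
      (d1'.comp_tendsto hσσ).congr_right fun x => by simp only [Function.comp, hτσ]
    have g3 : (fun x => p (σ (σ x)) * (U * s (σ (σ x)) + A * (1 - p (σ (σ x))))) =O[L]
        fun _ => (1 : ℂ) := by
      have h1 := (hps'.comp_tendsto hσσ).const_mul_left U
      have h2 := ((hp'.comp_tendsto hσσ).mul hqσσ).const_mul_left A
      refine (h1.add (h2.congr_right fun x => by simp)).congr_left fun x => ?_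
      simp only [Function.comp]
      ring
    have g4 := (rτ.mul g3).congr_right (g₂ := τ) fun x => by ring
    exact (g1.mul (g2.add g4)).congr (fun x => by ring) fun x => by ring
  exact (((f1.add f2).add f3).sub (f4.const_mul_left (1 / 2))).congr_left fun x => by
    simp only [hτσ]
    ring

lemma norm_exp_mul_I_sub_two (x : ℝ) : ‖cexp (x * I) - 1 - x * I‖ ≤ 4 * |x| ^ 2 := by
  have h1 := Real.norm_exp_I_mul_ofReal_sub_one_le (x := x)
  rw [mul_comm, Real.norm_eq_abs] at h1
  have hxI : ‖(x : ℂ) * I‖ = |x| := by simp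
  rcases le_or_gt |x| 1 with h | h
  · have h2 := Complex.norm_exp_sub_sum_le_norm_mul_exp (x * I) 2
    rw [hxI, Finset.sum_range_succ, Finset.sum_range_one] at h2
    have h3 : Real.exp |x| ≤ 4 :=
      (Real.exp_le_exp.2 h).trans (Real.exp_one_lt_d9.le.trans (by norm_num))
    have h4 : cexp (x * I) - ((x * I) ^ 0 / ((0).factorial : ℂ) +
        (x * I) ^ 1 / ((1).factorial : ℂ)) = cexp (x * I) - 1 - x * I := by
      simp
      ring
    rw [h4] at h2
    have : 0 ≤ |x| ^ 2 := by positivity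
    nlinarith
  · have h2 := norm_sub_le (cexp (x * I) - 1) (x * I)
    rw [hxI] at h2
    nlinarith

lemma norm_exp_mul_I_sub_three (x : ℝ) :
    ‖cexp (x * I) - 1 - x * I - (x * I) ^ 2 / 2‖ ≤ 5 * |x| ^ 3 := by
  have hxI : ‖(x : ℂ) * I‖ = |x| := by simp
  rcases le_or_gt |x| 1 with h | h
  · have h2 := Complex.norm_exp_sub_sum_le_norm_mul_exp (x * I) 3
    rw [hxI, Finset.sum_range_succ, Finset.sum_range_succ, Finset.sum_range_one] at h2
    have h3 : Real.exp |x| ≤ 4 :=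
      (Real.exp_le_exp.2 h).trans (Real.exp_one_lt_d9.le.trans (by norm_num))
    have h4 : cexp (x * I) - ((x * I) ^ 0 / ((0).factorial : ℂ) +
        (x * I) ^ 1 / ((1).factorial : ℂ) + (x * I) ^ 2 / ((2).factorial : ℂ)) =
        cexp (x * I) - 1 - x * I - (x * I) ^ 2 / 2 := by
      simp
      ring
    rw [h4] at h2
    have : 0 ≤ |x| ^ 3 := by positivity
    nlinarith
  · have h1 := norm_exp_mul_I_sub_two x
    have h2 := norm_sub_le (cexp (x * I) - 1 - x * I) ((x * I) ^ 2 / 2)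
    have h3 : ‖((x : ℂ) * I) ^ 2 / 2‖ = |x| ^ 2 / 2 := by
      rw [norm_div, norm_pow, hxI]
      norm_num
    rw [h3] at h2
    have h4 : |x| ^ 2 ≤ |x| ^ 3 := by
      apply pow_le_pow_right₀ h.le (by norm_num)
    nlinarith

/-- The Fermi function `1 / (e^x + 1)`. -/
noncomputable def fermi (x : ℝ) : ℝ := 1 / (Real.exp x + 1)

lemma fermi_pos (x : ℝ) : 0 < fermi x := by
  unfold fermi
  positivity

lemma fermi_le_exp (x : ℝ) : fermi x ≤ Real.exp (-x) := by
  rw [fermi, Real.exp_neg, one_div]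
  gcongr
  linarith

lemma fermi_le_one (x : ℝ) : fermi x ≤ 1 := by
  rw [fermi, div_le_one (by positivity)]
  linarith [Real.exp_pos x]

lemma pow_mul_fermi_le {x : ℝ} (hx : 0 ≤ x) (k : ℕ) :
    fermi x * x ^ k ≤ 2 ^ k * k.factorial * Real.exp (-x / 2) := by
  have h1 := Real.pow_div_factorial_le_exp (x / 2) (by positivity) k
  have h2 : x ^ k ≤ 2 ^ k * k.factorial * Real.exp (x / 2) := by
    rw [div_pow, div_div, div_le_iff₀ (by positivity)] at h1
    linarith
  calc fermi x * x ^ k ≤ Real.exp (-x) * (2 ^ k * k.factorial * Real.exp (x / 2)) := by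
        gcongr
        exact fermi_le_exp x
    _ = 2 ^ k * k.factorial * (Real.exp (-x) * Real.exp (x / 2)) := by ring
    _ = _ := by
        rw [← Real.exp_add]
        congr 2
        ring

lemma mul_fermi_le_one (x : ℝ) : fermi x * x ≤ 1 := by
  rw [fermi, one_div_mul_eq_div, div_le_one (by positivity)]
  linarith [Real.add_one_le_exp x]

lemma abs_fermi_add_sub_le (x : ℝ) {h : ℝ} (hh : 0 ≤ h) :
    |fermi (x + h) - fermi x| ≤ h * fermi x := by
  have h1 : fermi (x + h) ≤ fermi x := by
    unfold fermi
    gcongr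
    linarith
  rw [abs_of_nonpos (by linarith)]
  have h2 : fermi x - fermi (x + h) = fermi x * ((Real.exp (x + h) - Real.exp x) *
      fermi (x + h)) := by
    unfold fermi
    field_simp
    ring
  have h3 : (Real.exp (x + h) - Real.exp x) * fermi (x + h) ≤ h := by
    have e1 : Real.exp x = Real.exp (x + h) * Real.exp (-h) := by
      rw [← Real.exp_add]
      congr 1
      ring
    have e2 := Real.add_one_le_exp (-h)
    have e3 : Real.exp (x + h) * fermi (x + h) ≤ 1 := by
      rw [fermi, mul_one_div, div_le_one (by positivity)]
      linarith
    have e4 := fermi_pos (x + h)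
    have e5 := Real.exp_pos (x + h)
    have e6 : Real.exp (-h) ≤ 1 := Real.exp_le_one_iff.2 (by linarith)
    rw [e1]
    calc _ = (Real.exp (x + h) * fermi (x + h)) * (1 - Real.exp (-h)) := by ring
      _ ≤ 1 * h := by
        gcongr
        linarith
      _ = h := one_mul h
  have := fermi_pos x
  nlinarith

/-- The deviation `δ` of the normalised ratio at site `m` from `1`, for the weights with
`τ = √β`, angle `u τ³` and `T = e^{Aτ}`. -/
noncomputable def dev (t : ℕ) (A u : ℝ) (x : ℝ × ℕ) : ℂ :=
  (fermi (x.1 * (2 * x.2 + 1)) : ℂ) *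
    ((cexp (u * √x.1 * (x.1 * (2 * x.2 + 1)) * I) - 1) +
      cexp (u * √x.1 * (x.1 * (2 * x.2 + 1)) * I) * (cexp (A * √x.1) - 1) *
        transferC t (Real.exp (A * √x.1) : ℝ) (bw x.1 (u * √x.1 ^ 3)) x.2)

lemma transferR_mul (t : ℕ) (A u : ℝ) {x : ℝ × ℕ} (hx : 0 < x.1) :
    (1 - (fermi (x.1 * (2 * x.2 + 1)) : ℂ)) *
      transferR t (Real.exp (A * √x.1) : ℝ) (bw x.1 (u * √x.1 ^ 3)) x.2 = 1 + dev t A u x := by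
  have h1 : (1 - (fermi (x.1 * (2 * x.2 + 1)) : ℂ)) * bw x.1 (u * √x.1 ^ 3) x.2 =
      (fermi (x.1 * (2 * x.2 + 1)) : ℂ) * cexp (u * √x.1 * (x.1 * (2 * x.2 + 1)) * I) := by
    have h2 : bw x.1 (u * √x.1 ^ 3) x.2 = (Real.exp (-(x.1 * (2 * x.2 + 1))) : ℝ) *
        cexp (u * √x.1 * (x.1 * (2 * x.2 + 1)) * I) := by
      rw [bw, Complex.ofReal_exp, ← Complex.exp_add]
      congr 1
      have h3 : ((√x.1 : ℝ) : ℂ) ^ 2 = x.1 := by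
        rw [← Complex.ofReal_pow, Real.sq_sqrt hx.le]
      push_cast
      linear_combination (u * √x.1 * (2 * x.2 + 1) * I) * h3
    have h3 : (1 - fermi (x.1 * (2 * x.2 + 1))) * Real.exp (-(x.1 * (2 * x.2 + 1))) =
        fermi (x.1 * (2 * x.2 + 1)) := by
      rw [fermi, Real.exp_neg]
      field_simp
      ring
    rw [h2, ← mul_assoc]
    congr 1
    exact_mod_cast h3
  rw [transferR, dev]
  rw [mul_add, mul_one, ← mul_assoc, h1]
  push_cast
  ring

lemma transferC_bound {t : ℕ} (ht : 1 ≤ t) (A u : ℝ) {β : ℝ} (hβ : 0 < β)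
    (h1 : |u| * √β ≤ 1 / 4) (h2 : ‖cexp (A * √β) - 1‖ ≤ 1 / 8) (m : ℕ) :
    ‖transferC t (Real.exp (A * √β) : ℝ) (bw β (u * √β ^ 3)) m‖ ≤ 2 ∧
      ‖dev t A u (β, m)‖ ≤ 1 / 2 := by
  induction m using Nat.strong_induction_on with
  | _ m ih =>
    have hc : ‖transferC t (Real.exp (A * √β) : ℝ) (bw β (u * √β ^ 3)) m‖ ≤ 2 := by
      rcases lt_or_ge m t with h | h
      · rw [transferC_of_lt _ _ h]
        norm_num
      · obtain ⟨k, rfl⟩ := Nat.exists_eq_add_of_le' h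
        have h3 := (ih k (by omega)).2
        have h4 := transferR_mul t A u (x := (β, k)) hβ
        rw [transferC_add ht]
        rw [transferR] at h4
        dsimp only at h4
        set R := 1 + bw β (u * √β ^ 3) k * (1 + ((Real.exp (A * √β) : ℝ) - 1) *
          transferC t (Real.exp (A * √β) : ℝ) (bw β (u * √β ^ 3)) k)
        have h5 : 1 / 2 ≤ ‖1 + dev t A u (β, k)‖ := by
          have := norm_sub_le_norm_add (1 : ℂ) (dev t A u (β, k))
          rw [norm_one] at this
          linarith
        rw [← h4, norm_mul] at h5
        have h6 : ‖(1 - (fermi (β * (2 * k + 1)) : ℂ))‖ ≤ 1 := by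
          rw [← Complex.ofReal_one, ← Complex.ofReal_sub, Complex.norm_real, Real.norm_eq_abs,
            abs_of_nonneg (by linarith [fermi_le_one (β * (2 * k + 1))])]
          linarith [fermi_pos (β * (2 * k + 1))]
        have h7 : 1 / 2 ≤ ‖R‖ := by nlinarith [norm_nonneg R]
        rw [norm_div, norm_one, div_le_iff₀ (by linarith)]
        linarith
    refine ⟨hc, ?_⟩
    have hs : 0 ≤ β * (2 * m + 1) := by positivity
    have hz : ‖cexp (u * √β * (β * (2 * m + 1)) * I) - 1‖ ≤ |u| * √β * (β * (2 * m + 1)) := by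
      have := Real.norm_exp_I_mul_ofReal_sub_one_le (x := u * √β * (β * (2 * m + 1)))
      rw [mul_comm I, Real.norm_eq_abs, abs_mul, abs_mul, abs_of_nonneg hs,
        abs_of_nonneg (Real.sqrt_nonneg β)] at this
      push_cast at this
      exact this
    have hz1 : ‖cexp (u * √β * (β * (2 * m + 1)) * I)‖ = 1 := by
      have := Complex.norm_exp_ofReal_mul_I (u * √β * (β * (2 * m + 1)))
      push_cast at this
      exact this
    have hf := fermi_pos (β * (2 * m + 1))
    have hf1 := fermi_le_one (β * (2 * m + 1))
    have hf2 := mul_fermi_le_one (β * (2 * m + 1))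
    rw [dev, norm_mul, Complex.norm_real, Real.norm_of_nonneg hf.le]
    dsimp only
    set c := ‖transferC t (Real.exp (A * √β) : ℝ) (bw β (u * √β ^ 3)) m‖ with hcdef
    calc _ ≤ fermi (β * (2 * m + 1)) * (|u| * √β * (β * (2 * m + 1)) + 1 * (1 / 8) * 2) := by
          gcongr
          refine (norm_add_le _ _).trans ?_
          rw [norm_mul, norm_mul, hz1]
          gcongr
      _ = |u| * √β * (fermi (β * (2 * m + 1)) * (β * (2 * m + 1))) +
          fermi (β * (2 * m + 1)) * (1 / 4) := by ring
      _ ≤ 1 / 4 * 1 + 1 * (1 / 4) := by gcongr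
      _ = 1 / 2 := by norm_num

/-- The first-order coefficient of the expansion of `log (1 + dev)`. -/
noncomputable def coeffOne (A u s : ℝ) : ℂ :=
  fermi s * (u * I * s + A * (1 - fermi s))

/-- The second-order coefficient of the expansion of `log (1 + dev)`. -/
noncomputable def coeffTwo (A u s : ℝ) : ℂ :=
  fermi s * ((u * I * s) ^ 2 / 2 + u * I * s * A * (1 - fermi s) + A ^ 2 * (1 - fermi s) / 2)
    - fermi s * A * ((1 - fermi s) * fermi s * (u * I * s + A * (1 - fermi s)))
    - (fermi s * (u * I * s + A * (1 - fermi s))) ^ 2 / 2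

lemma dev_isBigO {t : ℕ} (ht : 1 ≤ t) (A u : ℝ) :
    dev t A u =O[𝓝[>] (0 : ℝ) ×ˢ 𝓟 (Set.univ : Set ℕ)]
      (fun x => (√x.1 : ℂ) * (Real.exp (-(x.1 * (2 * x.2 + 1)) / 2) : ℝ)) ∧
    (fun x : ℝ × ℕ => dev t A u (x.1, x.2 + t + t) - dev t A u (x.1, x.2 + t + t) ^ 2 / 2 -
      (√x.1 * coeffOne A u (x.1 * (2 * (x.2 + t + t : ℕ) + 1)) +
        (√x.1 : ℂ) ^ 2 * coeffTwo A u (x.1 * (2 * (x.2 + t + t : ℕ) + 1))))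
      =O[𝓝[>] (0 : ℝ) ×ˢ 𝓟 (Set.univ : Set ℕ)]
      (fun x => (√x.1 : ℂ) ^ 3 * (Real.exp (-(x.1 * (2 * (x.2 + t + t : ℕ) + 1)) / 2) : ℝ)) := by
  set L := 𝓝[>] (0 : ℝ) ×ˢ 𝓟 (Set.univ : Set ℕ) with hL
  have hpos : ∀ᶠ x in L, 0 < x.1 := by
    have : ∀ᶠ b in 𝓝[>] (0 : ℝ), 0 < b := self_mem_nhdsWithin
    exact this.prod_inl _
  have hsqrt : Tendsto (fun x : ℝ × ℕ => √x.1) L (𝓝 0) := by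
    have h1 : Tendsto (fun b : ℝ => √b) (𝓝[>] (0 : ℝ)) (𝓝 0) := by
      have := (Real.continuous_sqrt.tendsto 0).mono_left (nhdsWithin_le_nhds (s := Set.Ioi 0))
      rwa [Real.sqrt_zero] at this
    exact h1.comp tendsto_fst
  have hτ1 : ∀ᶠ x in L, √x.1 ≤ 1 := hsqrt.eventually_le_const one_pos
  have hAτ : Tendsto (fun x : ℝ × ℕ => (A * √x.1 : ℂ)) L (𝓝 0) := by
    have h2 : Tendsto (fun x : ℝ × ℕ => ((√x.1 : ℝ) : ℂ)) L (𝓝 0) := by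
      have := (Complex.continuous_ofReal.tendsto 0).comp hsqrt
      simpa [Function.comp_def] using this
    simpa using h2.const_mul (A : ℂ)
  have hw8 : ∀ᶠ x in L, ‖cexp (A * √x.1) - 1‖ ≤ 1 / 8 := by
    have h2 : Tendsto (fun x : ℝ × ℕ => ‖cexp (A * √x.1) - 1‖) L (𝓝 0) := by
      have := (((Complex.continuous_exp.tendsto 0).comp hAτ).sub_const 1).norm
      simpa [Function.comp_def] using this
    exact h2.eventually_le_const (by norm_num)
  have hu4 : ∀ᶠ x in L, |u| * √x.1 ≤ 1 / 4 := by
    have h2 : Tendsto (fun x : ℝ × ℕ => |u| * √x.1) L (𝓝 0) := by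
      simpa using hsqrt.const_mul |u|
    exact h2.eventually_le_const (by norm_num)
  have hexp (k : ℕ) := (Complex.exp_sub_sum_range_isBigO_pow k).comp_tendsto hAτ
  have hAk (k : ℕ) : (fun x : ℝ × ℕ => (A * √x.1 : ℂ) ^ k) =O[L] fun x => (√x.1 : ℂ) ^ k :=
    (isBigO_const_mul_self ((A : ℂ) ^ k) (fun x : ℝ × ℕ => (√x.1 : ℂ) ^ k) L).congr_left
      fun x => by ring
  have main := isBigO_deviation_expansion (L := L) (σ := fun x : ℝ × ℕ => (x.1, x.2 + t))
    (p := fun x => (fermi (x.1 * (2 * x.2 + 1)) : ℂ))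
    (s := fun x => ((x.1 * (2 * x.2 + 1) : ℝ) : ℂ))
    (ζ := fun x => cexp (u * √x.1 * (x.1 * (2 * x.2 + 1)) * I))
    (w := fun x => cexp (A * √x.1) - 1)
    (c := fun x => transferC t (Real.exp (A * √x.1) : ℝ) (bw x.1 (u * √x.1 ^ 3)) x.2)
    (δ := dev t A u) (τ := fun x => (√x.1 : ℂ))
    (e := fun x => ((Real.exp (-(x.1 * (2 * x.2 + 1)) / 2) : ℝ) : ℂ)) ?_ (A : ℂ) (u * I : ℂ)
    ?_ ?_ ?_ ?_ ?_ ?_ ?_ ?_ ?_ ?_ ?_ ?_ ?_ ?_ ?_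
  · exact ⟨main.1, main.2.congr_left fun x => by simp only [coeffOne, coeffTwo]⟩
  · exact tendsto_fst.prodMk (by rw [principal_univ]; exact tendsto_top)
  · refine IsBigO.of_bound 1 ?_
    filter_upwards [hτ1] with x hx
    simpa [abs_of_nonneg (Real.sqrt_nonneg _)] using hx
  · refine IsBigO.of_bound 1 ?_
    filter_upwards [hpos] with x hx
    rw [Complex.norm_real, Real.norm_of_nonneg (Real.exp_pos _).le]
    simp only [norm_one, mul_one, Real.exp_le_one_iff]
    have : 0 ≤ x.1 * (2 * x.2 + 1) := by positivity
    linarith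
  · intro k hk
    refine IsBigO.of_bound (2 ^ k * k.factorial) ?_
    filter_upwards [hpos] with x hx
    have hs : 0 ≤ x.1 * (2 * x.2 + 1) := by positivity
    have := pow_mul_fermi_le hs k
    rw [norm_mul, norm_pow, Complex.norm_real, Complex.norm_real, Complex.norm_real,
      Real.norm_of_nonneg (Real.exp_pos _).le, Real.norm_of_nonneg hs,
      Real.norm_of_nonneg (fermi_pos _).le]
    exact this
  · refine IsBigO.of_bound |u| ?_
    filter_upwards with x
    have := Real.norm_exp_I_mul_ofReal_sub_one_le (x := u * √x.1 * (x.1 * (2 * x.2 + 1)))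
    rw [mul_comm I] at this
    push_cast at this
    refine this.trans (le_of_eq ?_)
    rw [← Complex.ofReal_mul, Complex.norm_real, mul_assoc u, norm_mul, Real.norm_eq_abs u]
  · refine IsBigO.of_bound (4 * |u| ^ 2) ?_
    filter_upwards with x
    have := norm_exp_mul_I_sub_two (u * √x.1 * (x.1 * (2 * x.2 + 1)))
    push_cast at this ⊢
    convert this using 1
    · congr 2
      ring
    · simp only [norm_mul, norm_pow, Complex.norm_real, ← Complex.ofReal_mul, abs_mul,
        Real.norm_eq_abs, ← Complex.ofReal_natCast, ← Complex.ofReal_add, ← Complex.ofReal_one,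
        ← Complex.ofReal_ofNat]
      ring
  · refine IsBigO.of_bound (5 * |u| ^ 3) ?_
    filter_upwards with x
    have := norm_exp_mul_I_sub_three (u * √x.1 * (x.1 * (2 * x.2 + 1)))
    push_cast at this ⊢
    convert this using 1
    · congr 2
      · ring
      · ring
    · simp only [norm_mul, norm_pow, Complex.norm_real, ← Complex.ofReal_mul, abs_mul,
        Real.norm_eq_abs, ← Complex.ofReal_natCast, ← Complex.ofReal_add, ← Complex.ofReal_one,
        ← Complex.ofReal_ofNat]
      ring
  · refine ((hexp 1).trans (hAk 1)).congr (fun x => ?_) (fun x => ?_) <;>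
      simp
  · refine ((hexp 2).trans (hAk 2)).congr (fun x => ?_) (fun x => ?_)
    · simp [Finset.sum_range_succ]
      ring
    · simp
  · refine ((hexp 3).trans (hAk 3)).congr (fun x => ?_) (fun x => ?_)
    · simp [Finset.sum_range_succ]
      ring
    · simp
  · refine IsBigO.of_bound 2 ?_
    filter_upwards [hpos, hw8, hu4] with x h1 h2 h3
    simpa using (transferC_bound ht A u h1 h3 h2 x.2).1
  · intro x
    rw [dev]
  · filter_upwards [hpos, hw8, hu4] with x h1 h2 h3
    have h4 := transferR_mul t A u h1
    have h5 := (transferC_bound ht A u h1 h3 h2 x.2).2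
    have h6 : 1 + dev t A u x ≠ 0 := by
      intro h
      have : dev t A u x = -1 := by linear_combination h
      have h7 : ‖dev t A u x‖ ≤ 1 / 2 := h5
      rw [this] at h7
      norm_num at h7
    rw [← h4] at h6 ⊢
    rw [transferC_add ht, ← transferR]
    rw [mul_left_comm, one_div_mul_cancel (right_ne_zero_of_mul h6), mul_one]
  · refine IsBigO.of_bound (2 * t) ?_
    filter_upwards [hpos] with x hx
    have := abs_fermi_add_sub_le (x.1 * (2 * x.2 + 1)) (h := 2 * t * x.1) (by positivity)
    rw [← Complex.ofReal_sub, Complex.norm_real, norm_mul, norm_pow, Complex.norm_real,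
      Complex.norm_real, Real.norm_of_nonneg (fermi_pos _).le, Real.norm_eq_abs, Real.norm_eq_abs,
      sq_abs, Real.sq_sqrt hx.le]
    refine le_trans (le_of_eq ?_) (this.trans (le_of_eq ?_))
    · push_cast
      ring_nf
    · ring
  · refine IsBigO.of_bound (2 * t) ?_
    filter_upwards [hpos] with x hx
    rw [← Complex.ofReal_sub, Complex.norm_real, norm_pow, Complex.norm_real, Real.norm_eq_abs,
      Real.norm_eq_abs, sq_abs, Real.sq_sqrt hx.le]
    apply le_of_eq
    rw [← abs_of_pos (a := 2 * t * x.1) (by positivity)]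
    push_cast
    ring_nf
  · intro x
    rfl

lemma exists_norm_dev_le {t : ℕ} (ht : 1 ≤ t) (A u : ℝ) :
    ∃ C, 0 ≤ C ∧ ∀ᶠ β in 𝓝[>] (0 : ℝ), ∀ m : ℕ,
      ‖dev t A u (β, m)‖ ≤ C * (√β * Real.exp (-(β * (2 * m + 1)) / 2)) ∧
      (t + t ≤ m → ‖dev t A u (β, m) - dev t A u (β, m) ^ 2 / 2 -
        (√β * coeffOne A u (β * (2 * m + 1)) + (√β : ℂ) ^ 2 * coeffTwo A u (β * (2 * m + 1)))‖ ≤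
        C * (√β ^ 3 * Real.exp (-(β * (2 * m + 1)) / 2))) := by
  obtain ⟨h1, h2⟩ := dev_isBigO ht A u
  obtain ⟨C1, h1⟩ := h1.bound
  obtain ⟨C2, h2⟩ := h2.bound
  rw [eventually_prod_principal_iff] at h1 h2
  refine ⟨max (max C1 C2) 0, le_max_right _ _, ?_⟩
  filter_upwards [h1, h2] with β h1 h2 m
  constructor
  · refine (h1 m trivial).trans ?_
    rw [norm_mul, Complex.norm_real, Complex.norm_real, Real.norm_of_nonneg (Real.exp_pos _).le,
      Real.norm_of_nonneg (Real.sqrt_nonneg _)]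
    gcongr
    exact (le_max_left _ _).trans (le_max_left _ _)
  · intro hm
    obtain ⟨k, rfl⟩ := Nat.exists_eq_add_of_le' hm
    have := h2 k trivial
    rw [← add_assoc]
    refine this.trans ?_
    rw [norm_mul, norm_pow, Complex.norm_real, Complex.norm_real,
      Real.norm_of_nonneg (Real.exp_pos _).le, Real.norm_of_nonneg (Real.sqrt_nonneg _)]
    gcongr
    exact (le_max_right _ _).trans (le_max_left _ _)

lemma mul_sum_exp_le_one {β : ℝ} (hβ : 0 ≤ β) (N : ℕ) :
    β * ∑ m ∈ Finset.range N, Real.exp (-(β * (2 * m + 1)) / 2) ≤ 1 := by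
  have key (m : ℕ) : β * Real.exp (-(β * (2 * m + 1)) / 2) ≤
      Real.exp (-(β * m)) - Real.exp (-(β * (m + 1 : ℕ))) := by
    have h1 : Real.exp (-(β * m)) = Real.exp (-(β * (2 * m + 1)) / 2) * Real.exp (β / 2) := by
      rw [← Real.exp_add]
      congr 1
      ring
    have h2 : Real.exp (-(β * (m + 1 : ℕ))) =
        Real.exp (-(β * (2 * m + 1)) / 2) * Real.exp (-(β / 2)) := by
      rw [← Real.exp_add]
      congr 1
      push_cast
      ring
    have h3 : β / 2 ≤ Real.sinh (β / 2) := Real.self_le_sinh_iff.2 (by linarith)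
    rw [Real.sinh_eq] at h3
    rw [h1, h2]
    have := Real.exp_pos (-(β * (2 * m + 1)) / 2)
    nlinarith
  rw [Finset.mul_sum]
  refine (Finset.sum_le_sum fun m _ => key m).trans ?_
  rw [Finset.sum_range_sub']
  simp [Real.exp_nonneg]

lemma norm_coeffOne_le (A u : ℝ) {s : ℝ} (hs : 0 ≤ s) : ‖coeffOne A u s‖ ≤ |u| + |A| := by
  have h1 := fermi_pos s
  have h2 := fermi_le_one s
  have h3 := mul_fermi_le_one s
  have h4 : coeffOne A u s = (u * (fermi s * s) : ℝ) * I + (A * (fermi s * (1 - fermi s)) : ℝ) := by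
    rw [coeffOne]
    push_cast
    ring
  rw [h4]
  refine (norm_add_le _ _).trans ?_
  rw [norm_mul, norm_I, Complex.norm_real, Complex.norm_real, Real.norm_eq_abs, Real.norm_eq_abs,
    abs_mul u, abs_mul A, abs_of_nonneg (a := fermi s * s) (by positivity),
    abs_of_nonneg (a := fermi s * (1 - fermi s)) (by nlinarith)]
  have := abs_nonneg u
  have := abs_nonneg A
  have h5 : fermi s * (1 - fermi s) ≤ 1 := by nlinarith
  nlinarith

lemma norm_coeffTwo_le (A u : ℝ) {s : ℝ} (hs : 0 ≤ s) :
    ‖coeffTwo A u s‖ ≤ 4 * |u| ^ 2 + |u| * |A| + A ^ 2 + |A| * (|u| + |A|) +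
      (|u| + |A|) ^ 2 / 2 := by
  have h1 := fermi_pos s
  have h2 := fermi_le_one s
  have h3 := mul_fermi_le_one s
  have h6 : fermi s * s ^ 2 ≤ 8 := by
    have := pow_mul_fermi_le hs 2
    have h7 : Real.exp (-s / 2) ≤ 1 := Real.exp_le_one_iff.2 (by linarith)
    norm_num at this
    linarith
  have hq : ‖(1 - fermi s : ℂ)‖ ≤ 1 := by
    rw [← Complex.ofReal_one, ← Complex.ofReal_sub, Complex.norm_real, Real.norm_of_nonneg] <;>
      linarith
  have hp : ‖(fermi s : ℂ)‖ ≤ 1 := by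
    rwa [Complex.norm_real, Real.norm_of_nonneg h1.le]
  have h8 := norm_coeffOne_le A u hs
  have h9 : coeffTwo A u s = -((u ^ 2 * (fermi s * s ^ 2) / 2 : ℝ) : ℂ) +
      (u * A * (fermi s * s) : ℝ) * I * (1 - fermi s) + A ^ 2 * fermi s * (1 - fermi s) / 2
      - A * (fermi s * (1 - fermi s)) * coeffOne A u s - coeffOne A u s ^ 2 / 2 := by
    rw [coeffTwo, coeffOne]
    push_cast
    linear_combination (u ^ 2 * (fermi s * s ^ 2) / 2) * I_sq
  have e1 : ‖-((u ^ 2 * (fermi s * s ^ 2) / 2 : ℝ) : ℂ)‖ ≤ 4 * |u| ^ 2 := by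
    rw [norm_neg, Complex.norm_real, Real.norm_of_nonneg (by positivity), sq_abs]
    nlinarith [sq_nonneg u]
  have e2 : ‖((u * A * (fermi s * s) : ℝ) : ℂ) * I * (1 - fermi s)‖ ≤ |u| * |A| := by
    rw [norm_mul, norm_mul, norm_I, Complex.norm_real, Real.norm_eq_abs, abs_mul, abs_mul u,
      abs_of_nonneg (a := fermi s * s) (by positivity)]
    calc _ ≤ |u| * |A| * 1 * 1 * 1 := by gcongr
      _ = _ := by ring
  have e3 : ‖(A ^ 2 * fermi s * (1 - fermi s) / 2 : ℂ)‖ ≤ A ^ 2 := by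
    rw [norm_div, norm_mul, norm_mul, norm_pow, Complex.norm_real, Real.norm_eq_abs, sq_abs]
    calc _ ≤ A ^ 2 * 1 * 1 / 1 := by
          gcongr
          norm_num
      _ = _ := by ring
  have e4 : ‖A * (fermi s * (1 - fermi s)) * coeffOne A u s‖ ≤ |A| * (|u| + |A|) := by
    rw [norm_mul, norm_mul, norm_mul, Complex.norm_real A, Real.norm_eq_abs]
    calc _ ≤ |A| * (1 * 1) * (|u| + |A|) := by gcongr
      _ = _ := by ring
  have e5 : ‖coeffOne A u s ^ 2 / 2‖ ≤ (|u| + |A|) ^ 2 / 2 := by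
    rw [norm_div, norm_pow]
    norm_num
    gcongr
  rw [h9]
  refine (norm_sub_le _ _).trans (add_le_add ((norm_sub_le _ _).trans (add_le_add
    (norm_add₃_le.trans (add_le_add (add_le_add e1 e2) e3)) e4)) e5)

lemma norm_log_one_add_sub_le {z : ℂ} (hz : ‖z‖ ≤ 1 / 2) :
    ‖Complex.log (1 + z) - (z - z ^ 2 / 2)‖ ≤ ‖z‖ ^ 3 := by
  have h := Complex.norm_log_sub_logTaylor_le 2 (z := z) (by linarith)
  have h1 : logTaylor 3 z = z - z ^ 2 / 2 := by
    simp [logTaylor_succ, logTaylor_zero]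
    ring
  have h2 : (1 - ‖z‖)⁻¹ ≤ 2 := by
    rw [inv_le_comm₀ (by linarith) (by norm_num)]
    linarith
  rw [h1] at h
  refine h.trans ?_
  norm_num
  have : 0 ≤ ‖z‖ ^ 3 := by positivity
  nlinarith

/-- The product of the factors `1 + dev` is the exponential of the sum of the expansion terms, up
to an error `O(√β)` in the exponent. -/
lemma exists_prod_dev_eq_exp {t : ℕ} (ht : 1 ≤ t) (A u : ℝ) :
    ∃ C, ∀ᶠ β in 𝓝[>] (0 : ℝ), ∀ N : ℕ,
      ∏ m ∈ Finset.range N, (1 + dev t A u (β, m)) =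
        cexp (∑ m ∈ Finset.range N, Complex.log (1 + dev t A u (β, m))) ∧
      ‖∑ m ∈ Finset.range N, Complex.log (1 + dev t A u (β, m)) - ∑ m ∈ Finset.range N, (√β * coeffOne A u (β * (2 * m + 1)) +
        (√β : ℂ) ^ 2 * coeffTwo A u (β * (2 * m + 1)))‖ ≤ C * √β := by
  obtain ⟨C, hC, hdev⟩ := exists_norm_dev_le ht A u
  set K := 4 * |u| ^ 2 + |u| * |A| + A ^ 2 + |A| * (|u| + |A|) + (|u| + |A|) ^ 2 / 2
  have hK : 0 ≤ K := by positivity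
  have hsqrt : Tendsto (fun b : ℝ => √b) (𝓝[>] (0 : ℝ)) (𝓝 0) := by
    have := (Real.continuous_sqrt.tendsto 0).mono_left (nhdsWithin_le_nhds (s := Set.Ioi 0))
    rwa [Real.sqrt_zero] at this
  have hsm : ∀ᶠ β in 𝓝[>] (0 : ℝ), C * √β ≤ 1 / 2 := by
    have : Tendsto (fun b : ℝ => C * √b) (𝓝[>] (0 : ℝ)) (𝓝 0) := by simpa using hsqrt.const_mul C
    exact this.eventually_le_const (by norm_num)
  refine ⟨(C + C ^ 3) + (t + t : ℕ) * (2 * C + (|u| + |A|) + K), ?_⟩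
  filter_upwards [hdev, hsm, hsqrt.eventually_le_const one_pos, self_mem_nhdsWithin]
    with β hdev hsm hτ (hβ : 0 < β) N
  have hτ0 := Real.sqrt_nonneg β
  have hnorm (m : ℕ) : ‖dev t A u (β, m)‖ ≤ C * √β := by
    refine (hdev m).1.trans ?_
    have : Real.exp (-(β * (2 * m + 1)) / 2) ≤ 1 := by
      rw [Real.exp_le_one_iff]
      have : 0 ≤ β * (2 * m + 1) := by positivity
      linarith
    gcongr
    exact mul_le_of_le_one_right hτ0 this
  constructor
  · rw [Complex.exp_sum]
    refine Finset.prod_congr rfl fun m _ => (Complex.exp_log ?_).symm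
    intro h
    have h1 : dev t A u (β, m) = -1 := by linear_combination h
    have h2 := hnorm m
    rw [h1, norm_neg, norm_one] at h2
    linarith
  · have key (m : ℕ) : ‖Complex.log (1 + dev t A u (β, m)) -
        (√β * coeffOne A u (β * (2 * m + 1)) + (√β : ℂ) ^ 2 * coeffTwo A u (β * (2 * m + 1)))‖ ≤
        (C + C ^ 3) * √β ^ 3 * Real.exp (-(β * (2 * m + 1)) / 2) +
          if m < t + t then (2 * C + (|u| + |A|) + K) * √β else 0 := by
      have hs : 0 ≤ β * (2 * m + 1) := by positivity
      have hlog := norm_log_one_add_sub_le ((hnorm m).trans hsm)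
      have he : Real.exp (-(β * (2 * m + 1)) / 2) ≤ 1 := by
        rw [Real.exp_le_one_iff]
        linarith
      have he0 := Real.exp_pos (-(β * (2 * m + 1)) / 2)
      split_ifs with hm
      · have h1 : ‖(√β : ℂ) * coeffOne A u (β * (2 * m + 1))‖ ≤ √β * (|u| + |A|) := by
          rw [norm_mul, Complex.norm_real, Real.norm_of_nonneg hτ0]
          gcongr
          exact norm_coeffOne_le A u hs
        have h2 : ‖(√β : ℂ) ^ 2 * coeffTwo A u (β * (2 * m + 1))‖ ≤ √β * K := by
          rw [norm_mul, norm_pow, Complex.norm_real, Real.norm_of_nonneg hτ0]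
          gcongr
          · nlinarith
          · exact norm_coeffTwo_le A u hs
        have h3 : ‖Complex.log (1 + dev t A u (β, m))‖ ≤ 2 * C * √β := by
          have := Complex.norm_log_one_add_half_le_self ((hnorm m).trans hsm)
          have := hnorm m
          have : 0 ≤ ‖dev t A u (β, m)‖ := norm_nonneg _
          linarith
        have h4 : 0 ≤ (C + C ^ 3) * √β ^ 3 * Real.exp (-(β * (2 * m + 1)) / 2) := by positivity
        refine (norm_sub_le _ _).trans ?_
        have := norm_add_le ((√β : ℂ) * coeffOne A u (β * (2 * m + 1)))
          ((√β : ℂ) ^ 2 * coeffTwo A u (β * (2 * m + 1)))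
        linarith
      · have h1 := (hdev m).2 (by omega)
        have h2 : ‖dev t A u (β, m)‖ ^ 3 ≤ C ^ 3 * (√β ^ 3 * Real.exp (-(β * (2 * m + 1)) / 2)) := by
          calc _ ≤ (C * (√β * Real.exp (-(β * (2 * m + 1)) / 2))) ^ 3 := by
                gcongr
                exact (hdev m).1
            _ = C ^ 3 * (√β ^ 3 * Real.exp (-(β * (2 * m + 1)) / 2) ^ 3) := by ring
            _ ≤ _ := by
                gcongr
                exact pow_le_of_le_one he0.le he (by norm_num)
        rw [add_zero]
        have h3 := norm_add_le (Complex.log (1 + dev t A u (β, m)) -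
          (dev t A u (β, m) - dev t A u (β, m) ^ 2 / 2))
          (dev t A u (β, m) - dev t A u (β, m) ^ 2 / 2 - (√β * coeffOne A u (β * (2 * m + 1)) +
            (√β : ℂ) ^ 2 * coeffTwo A u (β * (2 * m + 1))))
        rw [sub_add_sub_cancel] at h3
        linarith
    rw [← Finset.sum_sub_distrib]
    refine (norm_sum_le_of_le _ fun m _ => key m).trans ?_
    rw [Finset.sum_add_distrib, ← Finset.mul_sum]
    have h1 := mul_sum_exp_le_one hβ.le N
    have h2 : ∑ m ∈ Finset.range N, (if m < t + t then (2 * C + (|u| + |A|) + K) * √β else 0) ≤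
        (t + t : ℕ) * (2 * C + (|u| + |A|) + K) * √β := by
      rw [← Finset.sum_filter, Finset.sum_const, nsmul_eq_mul, mul_assoc]
      have h3 : (Finset.filter (fun m => m < t + t) (Finset.range N)).card ≤ t + t := by
        calc _ ≤ (Finset.range (t + t)).card := Finset.card_le_card fun m hm => by
              simp only [Finset.mem_filter] at hm
              simpa using hm.2
          _ = _ := Finset.card_range _
      gcongr
    have h4 : (C + C ^ 3) * √β ^ 3 * ∑ m ∈ Finset.range N, Real.exp (-(β * (2 * m + 1)) / 2) ≤
        (C + C ^ 3) * √β := by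
      calc _ = (C + C ^ 3) * √β * (√β ^ 2 *
            ∑ m ∈ Finset.range N, Real.exp (-(β * (2 * m + 1)) / 2)) := by ring
        _ ≤ (C + C ^ 3) * √β * 1 := by
          rw [Real.sq_sqrt hβ.le]
          gcongr
        _ = _ := mul_one _
    linarith

lemma hasDerivAt_fermi (x : ℝ) : HasDerivAt fermi (-(fermi x * (1 - fermi x))) x := by
  have h1 : HasDerivAt (fun y => 1 / (Real.exp y + 1)) _ x :=
    (hasDerivAt_const x (1 : ℝ)).div ((Real.hasDerivAt_exp x).add_const 1) (by positivity)
  refine h1.congr_deriv ?_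
  unfold fermi
  field_simp
  ring

lemma continuous_fermi : Continuous fermi :=
  continuous_iff_continuousAt.2 fun x => (hasDerivAt_fermi x).continuousAt

/-- A differentiable function whose derivative decays like `e^{-x/2}` on the positive axis. -/
def DecayingDeriv (h : ℝ → ℂ) : Prop :=
  ∃ h' : ℝ → ℂ, (∀ x, HasDerivAt h (h' x) x) ∧ ∃ C, ∀ x, 0 ≤ x → ‖h' x‖ ≤ C * Real.exp (-x / 2)

lemma DecayingDeriv.add {f g : ℝ → ℂ} (hf : DecayingDeriv f) (hg : DecayingDeriv g) :
    DecayingDeriv (fun x => f x + g x) := by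
  obtain ⟨f', hf, C, hC⟩ := hf
  obtain ⟨g', hg, D, hD⟩ := hg
  refine ⟨fun x => f' x + g' x, fun x => (hf x).add (hg x), C + D, fun x hx => ?_⟩
  rw [add_mul]
  exact (norm_add_le _ _).trans (add_le_add (hC x hx) (hD x hx))

lemma DecayingDeriv.const_mul {f : ℝ → ℂ} (hf : DecayingDeriv f) (c : ℂ) :
    DecayingDeriv (fun x => c * f x) := by
  obtain ⟨f', hf, C, hC⟩ := hf
  refine ⟨fun x => c * f' x, fun x => (hf x).const_mul c, ‖c‖ * C, fun x hx => ?_⟩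
  rw [norm_mul, mul_assoc]
  gcongr
  exact hC x hx

lemma decayingDeriv_fermi (j k : ℕ) :
    DecayingDeriv (fun x => ((x ^ j * fermi x ^ (k + 1) : ℝ) : ℂ)) := by
  refine ⟨fun x => ((j * x ^ (j - 1) * fermi x ^ (k + 1) +
      x ^ j * (((k + 1 : ℕ) : ℝ) * fermi x ^ k * (-(fermi x * (1 - fermi x)))) : ℝ) : ℂ),
    fun x => ?_, j * (2 ^ (j - 1) * (j - 1).factorial) + (k + 1 : ℕ) * (2 ^ j * j.factorial),
    fun x hx => ?_⟩
  · exact ((hasDerivAt_pow j x).mul ((hasDerivAt_fermi x).pow (k + 1))).ofReal_comp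
  · have h1 := fermi_pos x
    have h2 := fermi_le_one x
    have h3 : fermi x ^ k ≤ 1 := pow_le_one₀ h1.le h2
    have h4 : |x ^ (j - 1) * fermi x ^ (k + 1)| ≤
        2 ^ (j - 1) * (j - 1).factorial * Real.exp (-x / 2) := by
      rw [abs_of_nonneg (by positivity)]
      refine le_trans ?_ (pow_mul_fermi_le hx (j - 1))
      calc _ = fermi x * x ^ (j - 1) * fermi x ^ k := by ring
        _ ≤ fermi x * x ^ (j - 1) * 1 := by gcongr
        _ = _ := mul_one _
    have h5 : |x ^ j * (fermi x ^ k * (-(fermi x * (1 - fermi x))))| ≤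
        2 ^ j * j.factorial * Real.exp (-x / 2) := by
      have : x ^ j * (fermi x ^ k * (-(fermi x * (1 - fermi x)))) =
        -(fermi x * x ^ j * (fermi x ^ k * (1 - fermi x))) := by ring
      have h6 : 0 ≤ 1 - fermi x := by linarith
      rw [this, abs_neg, abs_of_nonneg (by positivity)]
      refine le_trans ?_ (pow_mul_fermi_le hx j)
      apply mul_le_of_le_one_right (by positivity)
      exact mul_le_one₀ h3 h6 (by linarith)
    rw [Complex.norm_real, Real.norm_eq_abs, add_mul]
    refine (abs_add_le _ _).trans (add_le_add ?_ ?_)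
    · rw [mul_assoc, abs_mul, Nat.abs_cast, mul_assoc]
      gcongr
    · rw [mul_assoc ((k + 1 : ℕ) : ℝ), mul_left_comm, abs_mul, Nat.abs_cast, mul_assoc]
      gcongr

/-- Midpoint rule with exponentially decaying error. -/
lemma norm_midpoint_sub_le {H h : ℝ → ℂ} (hH : ∀ x, HasDerivAt H (h x) x)
    (hh : DecayingDeriv h) :
    ∃ C, ∀ β, 0 ≤ β → ∀ N : ℕ, β ≤ 1 →
      ‖2 * β * ∑ m ∈ Finset.range N, h (β * (2 * m + 1)) - (H (2 * β * N) - H 0)‖ ≤ C * β := by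
  obtain ⟨h', hh, C, hC⟩ := hh
  have hC0 : 0 ≤ C := by
    have := (norm_nonneg _).trans (hC 0 le_rfl)
    simpa using this
  refine ⟨8 * C, fun β hβ N hβ1 => ?_⟩
  have key (m : ℕ) : ‖2 * β * h (β * (2 * m + 1)) -
      (H (2 * β * (m + 1 : ℕ)) - H (2 * β * m))‖ ≤
      (8 * C * β) * (β * Real.exp (-(β * (2 * m + 1)) / 2)) := by
    set s := β * (2 * m + 1) with hs
    set e := Real.exp (-s / 2)
    have hab : 2 * β * m ≤ 2 * β * (m + 1 : ℕ) := by
      gcongr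
      simp
    have hm0 : 0 ≤ 2 * β * m := by positivity
    have hbd : ∀ x ∈ Set.Icc (2 * β * m) (2 * β * (m + 1 : ℕ)), ‖h' x‖ ≤ C * (2 * e) := by
      intro x hx
      refine (hC x (hm0.trans hx.1)).trans ?_
      gcongr
      have h1 : Real.exp (-x / 2) ≤ e * Real.exp (1 / 2) := by
        rw [← Real.exp_add, Real.exp_le_exp]
        have := hx.1
        nlinarith
      have h2 : Real.exp (1 / 2) ≤ 2 := by
        have := Real.exp_bound_div_one_sub_of_interval (x := 1 / 2) (by norm_num) (by norm_num)
        norm_num at this ⊢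
        linarith
      have h3 : 0 < e := Real.exp_pos _
      nlinarith
    have hsm : s ∈ Set.Icc (2 * β * m) (2 * β * (m + 1 : ℕ)) := by
      constructor
      · rw [hs]; nlinarith
      · rw [hs]; push_cast; nlinarith
    have hlip : ∀ x ∈ Set.Icc (2 * β * m) (2 * β * (m + 1 : ℕ)),
        ‖h x - h s‖ ≤ C * (2 * e) * (2 * β) := by
      intro x hx
      refine ((convex_Icc _ _).norm_image_sub_le_of_norm_hasDerivWithin_le
        (fun y _ => (hh y).hasDerivWithinAt) hbd hsm hx).trans ?_
      gcongr
      rw [Real.norm_eq_abs, abs_le]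
      have h1 := hx.1
      have h2 := hx.2
      have h3 := hsm.1
      have h4 := hsm.2
      push_cast at h2 h4
      constructor <;> nlinarith
    have hfin := (convex_Icc (2 * β * m) (2 * β * (m + 1 : ℕ))).norm_image_sub_le_of_norm_hasDerivWithin_le
        (f := fun x => H x - x * h s) (f' := fun x => h x - h s)
        (fun y _ => (((hH y).sub ((hasDerivAt_id y).ofReal_comp.mul_const (h s))).congr_deriv
          (by simp)).hasDerivWithinAt) hlip (Set.left_mem_Icc.2 hab) (Set.right_mem_Icc.2 hab)
    have h5 : ‖2 * β * (m + 1 : ℕ) - 2 * β * m‖ = 2 * β := by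
      rw [Real.norm_of_nonneg] <;> push_cast <;> nlinarith
    rw [h5] at hfin
    rw [norm_sub_rev]
    refine le_trans (le_of_eq ?_) (hfin.trans (le_of_eq (by ring)))
    congr 1
    push_cast
    ring
  have htel : H (2 * β * N) - H 0 =
      ∑ m ∈ Finset.range N, (H (2 * β * (m + 1 : ℕ)) - H (2 * β * m)) := by
    rw [Finset.sum_range_sub (fun m : ℕ => H (2 * β * m))]
    simp
  rw [htel, Finset.mul_sum, ← Finset.sum_sub_distrib]
  refine (norm_sum_le_of_le _ fun m _ => key m).trans ?_
  rw [← Finset.mul_sum, ← Finset.mul_sum]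
  exact mul_le_of_le_one_right (by positivity) (mul_sum_exp_le_one hβ N)

/-- The incomplete integral `∫₀ˣ y / (e^y + 1) dy`. -/
noncomputable def fermiInt (x : ℝ) : ℝ := ∫ y in (0)..x, y * fermi y

lemma hasDerivAt_fermiInt (x : ℝ) : HasDerivAt fermiInt (x * fermi x) x :=
  intervalIntegral.integral_hasDerivAt_right
    ((continuous_id.mul continuous_fermi).intervalIntegrable _ _)
    ((continuous_id.mul continuous_fermi).stronglyMeasurableAtFilter _ _)
    (continuous_id.mul continuous_fermi).continuousAt

lemma hasSum_alternating_two : HasSum (fun k : ℕ => (-1 : ℝ) ^ k / (k + 1) ^ 2) (π ^ 2 / 12) := by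
  have h0 : HasSum (fun n : ℕ => 1 / ((n : ℝ) + 1) ^ 2) (π ^ 2 / 6) := by
    have := (hasSum_nat_add_iff' 1).2 hasSum_zeta_two
    simpa using this
  have hodd : HasSum (fun k : ℕ => 1 / (((2 * k + 1 : ℕ) : ℝ) + 1) ^ 2) (π ^ 2 / 6 / 4) := by
    refine (h0.div_const 4).congr_fun fun k => ?_
    push_cast
    rw [div_div]
    congr 1
    ring
  have hs : Summable (fun k : ℕ => 1 / (((2 * k : ℕ) : ℝ) + 1) ^ 2) :=
    h0.summable.comp_injective (i := fun k : ℕ => 2 * k) fun a b h => by simpa using h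
  have h1 := h0.unique (HasSum.even_add_odd (f := fun n : ℕ => 1 / ((n : ℝ) + 1) ^ 2)
    hs.hasSum hodd)
  have h2 := HasSum.even_add_odd (f := fun k : ℕ => (-1 : ℝ) ^ k / ((k : ℝ) + 1) ^ 2)
    (m := ∑' k : ℕ, 1 / (((2 * k : ℕ) : ℝ) + 1) ^ 2) (m' := -(π ^ 2 / 6 / 4))
    (hs.hasSum.congr_fun fun k => ?_) (hodd.neg.congr_fun fun k => ?_)
  · have h3 : ∑' k : ℕ, 1 / (((2 * k : ℕ) : ℝ) + 1) ^ 2 + -(π ^ 2 / 6 / 4) = π ^ 2 / 12 := by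
      linarith
    rwa [h3] at h2
  · rw [pow_mul]
    norm_num
  · rw [pow_succ, pow_mul]
    norm_num
    ring

lemma hasSum_fermi {x : ℝ} (hx : 0 < x) :
    HasSum (fun k : ℕ => (-1 : ℝ) ^ k * Real.exp (-((k : ℝ) + 1) * x)) (fermi x) := by
  have h1 : ‖-Real.exp (-x)‖ < 1 := by
    rw [norm_neg, Real.norm_of_nonneg (Real.exp_pos _).le, Real.exp_lt_one_iff]
    linarith
  convert! (hasSum_geometric_of_norm_lt_one h1).mul_left (Real.exp (-x)) using 1
  · ext k
    rw [neg_pow (Real.exp (-x)), ← Real.exp_nat_mul, mul_left_comm, ← Real.exp_add]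
    ring_nf
  · rw [fermi, Real.exp_neg]
    field_simp
    rw [sub_neg_eq_add]
    exact (div_self (by positivity)).symm

lemma integral_fermi : ∫ x in Set.Ioi (0 : ℝ), x * fermi x = π ^ 2 / 12 := by
  have h := hasSum_mellin (a := fun k : ℕ => (-1 : ℂ) ^ k) (p := fun k : ℕ => (k : ℝ) + 1)
    (F := fun x => (fermi x : ℂ)) (s := 2) (fun k => Or.inr (by positivity)) (by norm_num)
    (fun x hx => by
      have := (Complex.hasSum_ofReal).2 (hasSum_fermi hx)
      simpa using this) ?_
  · have h2 := (Complex.hasSum_ofReal).2 hasSum_alternating_two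
    have h3 : HasSum (fun k : ℕ => (((-1 : ℝ) ^ k / (k + 1) ^ 2 : ℝ) : ℂ))
        (mellin (fun x => (fermi x : ℂ)) 2) := by
      convert! h using 1
      ext k
      have hG : Complex.Gamma 2 = 1 := by
        simp
      have h4 : (((k : ℝ) + 1 : ℝ) : ℂ) ^ (2 : ℂ) = (((k : ℝ) + 1 : ℝ) : ℂ) ^ 2 := by
        exact_mod_cast Complex.cpow_natCast (((k : ℝ) + 1 : ℝ) : ℂ) 2
      rw [hG, h4]
      push_cast
      ring
    have h4 := h3.unique h2
    rw [mellin] at h4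
    apply Complex.ofReal_injective
    rw [← h4, ← integral_complex_ofReal]
    refine MeasureTheory.setIntegral_congr_fun measurableSet_Ioi fun x _ => ?_
    norm_num
  · have := hasSum_zeta_two.summable
    have h5 := (summable_nat_add_iff 1).2 this
    refine h5.congr fun k => ?_
    norm_num

lemma fermiInt_bounds {x : ℝ} (hx : 0 < x) : |π ^ 2 / 12 - fermiInt x| ≤ 8 / x := by
  have hint (a : ℝ) (ha : 0 ≤ a) :
      MeasureTheory.IntegrableOn (fun y => y * fermi y) (Set.Ioi a) ∧
      ∫ y in Set.Ioi a, y * fermi y ≤ 4 * Real.exp (-a / 2) := by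
    have h1 : ∀ y ∈ Set.Ioi a, y * fermi y ≤ 2 * Real.exp (-(1 / 2) * y) := by
      intro y hy
      have := pow_mul_fermi_le (ha.trans (le_of_lt hy)) 1
      norm_num at this
      rw [mul_comm, show -(1 / 2) * y = -y / 2 by ring]
      exact this
    have h2 : MeasureTheory.IntegrableOn (fun y => 2 * Real.exp (-(1 / 2) * y)) (Set.Ioi a) :=
      (integrableOn_exp_mul_Ioi (by norm_num) a).const_mul 2
    have h3 : MeasureTheory.IntegrableOn (fun y => y * fermi y) (Set.Ioi a) := by
      refine h2.mono' (continuous_id.mul continuous_fermi).aestronglyMeasurable ?_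
      refine (MeasureTheory.ae_restrict_iff' measurableSet_Ioi).2 (Eventually.of_forall fun y hy => ?_)
      rw [Real.norm_of_nonneg (mul_nonneg (ha.trans (le_of_lt hy)) (fermi_pos y).le)]
      exact h1 y hy
    refine ⟨h3, (MeasureTheory.setIntegral_mono_on h3 h2 measurableSet_Ioi h1).trans (le_of_eq ?_)⟩
    rw [MeasureTheory.integral_const_mul, integral_exp_mul_Ioi (by norm_num)]
    rw [show -(1 / 2) * a = -a / 2 by ring]
    ring
  have h1 : π ^ 2 / 12 - fermiInt x = ∫ y in Set.Ioi x, y * fermi y := by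
    rw [← integral_fermi, fermiInt]
    have := intervalIntegral.integral_Ioi_sub_Ioi (hint 0 le_rfl).1 hx.le
    linarith
  have h2 : 0 ≤ ∫ y in Set.Ioi x, y * fermi y :=
    MeasureTheory.setIntegral_nonneg measurableSet_Ioi fun y hy =>
      mul_nonneg (hx.le.trans (le_of_lt hy)) (fermi_pos y).le
  rw [h1, abs_of_nonneg h2]
  refine (hint x hx.le).2.trans ?_
  rw [le_div_iff₀ hx]
  have h3 := Real.add_one_le_exp (x / 2)
  have h4 : Real.exp (-x / 2) * Real.exp (x / 2) = 1 := by
    rw [← Real.exp_add]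
    ring_nf
    exact Real.exp_zero
  have := Real.exp_pos (-x / 2)
  nlinarith

/-- An antiderivative of `coeffOne`. -/
noncomputable def antiOne (A u x : ℝ) : ℂ := u * I * fermiInt x - A * fermi x

/-- An antiderivative of `coeffTwo`. -/
noncomputable def antiTwo (A u x : ℝ) : ℂ :=
  -(u ^ 2 / 2) * (2 * fermiInt x - x ^ 2 * fermi x : ℝ) +
    u * A * I * (-(x * fermi x * (1 - fermi x) + fermi x) : ℝ) +
    A ^ 2 * (3 / 4 * fermi x ^ 2 - fermi x ^ 3 / 2 - fermi x / 2 : ℝ)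

lemma hasDerivAt_antiOne (A u x : ℝ) : HasDerivAt (antiOne A u) (coeffOne A u x) x := by
  refine (((hasDerivAt_fermiInt x).ofReal_comp.const_mul (u * I : ℂ)).sub
    ((hasDerivAt_fermi x).ofReal_comp.const_mul (A : ℂ))).congr_deriv ?_
  rw [coeffOne]
  push_cast
  ring

lemma hasDerivAt_antiTwo (A u x : ℝ) : HasDerivAt (antiTwo A u) (coeffTwo A u x) x := by
  have hp := hasDerivAt_fermi x
  have h1 := ((hasDerivAt_fermiInt x).const_mul 2).sub ((hasDerivAt_pow 2 x).mul hp)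
  have h2 := ((((hasDerivAt_id x).mul hp).mul (hp.const_sub 1)).add hp).neg
  have h3 := (((hp.pow 2).const_mul (3 / 4)).sub ((hp.pow 3).div_const 2)).sub (hp.div_const 2)
  refine (((h1.ofReal_comp.const_mul (-(u ^ 2 / 2) : ℂ)).add
    (h2.ofReal_comp.const_mul (u * A * I : ℂ))).add
    (h3.ofReal_comp.const_mul (A ^ 2 : ℂ))).congr_deriv ?_
  rw [coeffTwo]
  simp only [id, Pi.mul_apply]
  push_cast
  linear_combination -(fermi x * (1 - fermi x) * u ^ 2 * x ^ 2 / 2 : ℂ) * I_sq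

lemma decayingDeriv_coeffOne (A u : ℝ) : DecayingDeriv (coeffOne A u) := by
  have h := (((decayingDeriv_fermi 1 0).const_mul (u * I)).add
    ((decayingDeriv_fermi 0 0).const_mul A)).add ((decayingDeriv_fermi 0 1).const_mul (-A))
  convert h using 1
  ext x
  rw [coeffOne]
  push_cast
  ring

lemma decayingDeriv_coeffTwo (A u : ℝ) : DecayingDeriv (coeffTwo A u) := by
  have h := ((((((((decayingDeriv_fermi 2 0).const_mul (-(u ^ 2 / 2))).add
    ((decayingDeriv_fermi 2 1).const_mul (u ^ 2 / 2))).add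
    ((decayingDeriv_fermi 1 0).const_mul (u * A * I))).add
    ((decayingDeriv_fermi 1 1).const_mul (-(3 * u * A * I)))).add
    ((decayingDeriv_fermi 1 2).const_mul (2 * u * A * I))).add
    ((decayingDeriv_fermi 0 0).const_mul (A ^ 2 / 2))).add
    ((decayingDeriv_fermi 0 1).const_mul (-(2 * A ^ 2)))).add
    (((decayingDeriv_fermi 0 2).const_mul (3 * A ^ 2)).add
    ((decayingDeriv_fermi 0 3).const_mul (-(3 / 2 * A ^ 2))))
  convert h using 1
  ext x
  rw [coeffTwo]
  push_cast
  linear_combination (fermi x * (1 - fermi x) * u ^ 2 * x ^ 2 / 2 : ℂ) * I_sq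

lemma fermi_zero : fermi 0 = 1 / 2 := by
  norm_num [fermi]

lemma antiOne_zero (A u : ℝ) : antiOne A u 0 = -(A / 2) := by
  simp [antiOne, fermi_zero, fermiInt]
  ring

lemma antiTwo_zero (A u : ℝ) : antiTwo A u 0 = -(u * A * I / 2) - A ^ 2 / 8 := by
  simp [antiTwo, fermi_zero, fermiInt]
  ring

lemma norm_antiOne_sub_le (A u : ℝ) {x : ℝ} (hx : 0 < x) :
    ‖antiOne A u x - u * I * (π ^ 2 / 12)‖ ≤ (8 * |u| + |A|) / x := by
  have h1 := fermiInt_bounds hx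
  have h2 : fermi x ≤ 1 / x := by
    rw [le_div_iff₀ hx]
    exact mul_fermi_le_one x
  have h3 : antiOne A u x - u * I * (π ^ 2 / 12) =
      -(u * I * (π ^ 2 / 12 - fermiInt x : ℝ)) - A * fermi x := by
    rw [antiOne]
    push_cast
    ring
  rw [h3]
  refine (norm_sub_le _ _).trans ?_
  rw [norm_neg, norm_mul, norm_mul, norm_mul, norm_I, Complex.norm_real, Complex.norm_real,
    Complex.norm_real, Complex.norm_real, Real.norm_of_nonneg (fermi_pos x).le, Real.norm_eq_abs,
    Real.norm_eq_abs, Real.norm_eq_abs]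
  calc _ ≤ |u| * 1 * (8 / x) + |A| * (1 / x) := by gcongr
    _ = _ := by ring

lemma norm_antiTwo_sub_le (A u : ℝ) {x : ℝ} (hx : 0 < x) :
    ‖antiTwo A u x - (-(u ^ 2 * (π ^ 2 / 12)))‖ ≤
      (32 * u ^ 2 + 9 * (|u| * |A|) + 2 * A ^ 2) / x := by
  have h1 := fermiInt_bounds hx
  have hp := fermi_pos x
  have hp1 := fermi_le_one x
  have he : Real.exp (-x / 2) ≤ 1 := Real.exp_le_one_iff.2 (by linarith)
  have h2 : fermi x ≤ 1 / x := by
    rw [le_div_iff₀ hx]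
    exact mul_fermi_le_one x
  have h4 : x ^ 2 * fermi x ≤ 48 / x := by
    have := pow_mul_fermi_le hx.le 3
    norm_num [Nat.factorial] at this
    rw [le_div_iff₀ hx]
    linarith
  have h5 : x * fermi x ≤ 8 / x := by
    have := pow_mul_fermi_le hx.le 2
    norm_num at this
    rw [le_div_iff₀ hx]
    linarith
  have h3 : antiTwo A u x - (-(u ^ 2 * (π ^ 2 / 12))) =
      (u ^ 2 / 2 : ℝ) * (2 * (π ^ 2 / 12 - fermiInt x) + x ^ 2 * fermi x : ℝ) +
    (u * A : ℝ) * I * (-(x * fermi x * (1 - fermi x) + fermi x) : ℝ) +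
    (A ^ 2 : ℝ) * (3 / 4 * fermi x ^ 2 - fermi x ^ 3 / 2 - fermi x / 2 : ℝ) := by
    rw [antiTwo]
    push_cast
    ring
  rw [h3]
  refine norm_add₃_le.trans ?_
  simp only [norm_mul, norm_I, Complex.norm_real, Real.norm_eq_abs]
  have e1 : |2 * (π ^ 2 / 12 - fermiInt x) + x ^ 2 * fermi x| ≤ 64 / x := by
    refine (abs_add_le _ _).trans ?_
    rw [abs_mul, abs_of_nonneg (a := x ^ 2 * fermi x) (by positivity), abs_two]
    calc _ ≤ 2 * (8 / x) + 48 / x := by gcongr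
      _ = _ := by ring
  have e2 : |-(x * fermi x * (1 - fermi x) + fermi x)| ≤ 9 / x := by
    have h6 : x * fermi x * (1 - fermi x) ≤ x * fermi x :=
      mul_le_of_le_one_right (by positivity) (by linarith)
    have h7 : 0 ≤ x * fermi x * (1 - fermi x) := mul_nonneg (by positivity) (by linarith)
    rw [abs_neg, abs_of_nonneg (by positivity)]
    calc _ ≤ 8 / x + 1 / x := by linarith
      _ = _ := by ring
  have e3 : |3 / 4 * fermi x ^ 2 - fermi x ^ 3 / 2 - fermi x / 2| ≤ 2 / x := by
    have h6 : fermi x ^ 2 ≤ fermi x := pow_le_of_le_one hp.le hp1 (by norm_num)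
    have h7 : fermi x ^ 3 ≤ fermi x := pow_le_of_le_one hp.le hp1 (by norm_num)
    have h8 : 0 < fermi x ^ 2 := by positivity
    have h9 : 0 < fermi x ^ 3 := by positivity
    have h10 : 2 / x = 2 * (1 / x) := by ring
    rw [abs_le]
    constructor <;> linarith
  rw [abs_of_nonneg (a := u ^ 2 / 2) (by positivity), abs_of_nonneg (a := A ^ 2) (by positivity)]
  calc _ ≤ u ^ 2 / 2 * (64 / x) + |u| * |A| * 1 * (9 / x) + A ^ 2 * (2 / x) := by gcongr
    _ = _ := by ring

/-- The second-order asymptotics of the normalised generating function. -/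
lemma tendsto_prod_dev {t : ℕ} (ht : 1 ≤ t) (A u : ℝ) {ι : Type*} {l : Filter ι} {β : ι → ℝ}
    {N : ι → ℕ} (hβ : Tendsto β l (𝓝[>] 0)) (hN : ∀ᶠ i in l, 1 / 8 ≤ β i ^ 2 * N i) :
    Tendsto (fun i => (∏ m ∈ Finset.range (N i), (1 + dev t A u (β i, m))) *
      cexp (-((u * I * (π ^ 2 / 12) + A / 2) / (2 * √(β i))))) l
      (𝓝 (cexp (-(u ^ 2 * π ^ 2 / 24) + u * I * A / 4 + A ^ 2 / 16))) := by
  obtain ⟨C0, h0⟩ := exists_prod_dev_eq_exp ht A u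
  obtain ⟨C1, h1⟩ := norm_midpoint_sub_le (hasDerivAt_antiOne A u) (decayingDeriv_coeffOne A u)
  obtain ⟨C2, h2⟩ := norm_midpoint_sub_le (hasDerivAt_antiTwo A u) (decayingDeriv_coeffTwo A u)
  set D1 := 8 * |u| + |A|
  set D2 := 32 * u ^ 2 + 9 * (|u| * |A|) + 2 * A ^ 2
  have hβ0 : ∀ᶠ i in l, 0 < β i := hβ.eventually self_mem_nhdsWithin
  have hβ' : Tendsto β l (𝓝 0) := hβ.mono_right nhdsWithin_le_nhds
  have hsqrt : Tendsto (fun i => √(β i)) l (𝓝 0) := by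
    have := (Real.continuous_sqrt.tendsto 0).comp hβ'
    rwa [Real.sqrt_zero] at this
  set c : ℂ := -(u ^ 2 * π ^ 2 / 24) + u * I * A / 4 + A ^ 2 / 16 with hc
  have hE : Tendsto (fun i => ∑ m ∈ Finset.range (N i), Complex.log (1 + dev t A u (β i, m)) +
      (-((u * I * (π ^ 2 / 12) + A / 2) / (2 * √(β i))))) l (𝓝 c) := by
    rw [tendsto_iff_norm_sub_tendsto_zero]
    refine squeeze_zero' (g := fun i => (C0 + |C1| / 2 + 2 * D1 + |C2| / 2 + 2 * D2) * √(β i))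
      (Eventually.of_forall fun i => norm_nonneg _) ?_ (by simpa using hsqrt.const_mul _)
    filter_upwards [hβ.eventually h0, hβ0, hβ'.eventually_le_const one_pos, hN]
      with i h0 hb hb1 hN
    set b := β i
    set τ := √b
    have hτ : 0 < τ := Real.sqrt_pos.2 hb
    have hτb : τ ^ 2 = b := Real.sq_sqrt hb.le
    have hbτ : b ≤ τ := by
      have : τ ≤ 1 := Real.sqrt_le_one.2 hb1
      nlinarith
    have hτc : (τ : ℂ) ≠ 0 := by exact_mod_cast hτ.ne'
    have hτbc : (τ : ℂ) ^ 2 = b := by exact_mod_cast hτb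
    have hNpos : 0 < (N i : ℝ) := by
      by_contra h
      have : (N i : ℝ) = 0 := le_antisymm (not_lt.1 h) (Nat.cast_nonneg _)
      rw [this] at hN
      norm_num at hN
    have hx : 0 < 2 * b * N i := by positivity
    have hx4 : 1 / (2 * b * N i) ≤ 4 * b := by
      rw [div_le_iff₀ hx]
      nlinarith
    have e0 := (h0 (N i)).2
    have e1 := h1 b hb.le (N i) hb1
    have e2 := h2 b hb.le (N i) hb1
    have e3 := norm_antiOne_sub_le A u hx
    have e4 := norm_antiTwo_sub_le A u hx
    rw [antiOne_zero] at e1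
    rw [antiTwo_zero] at e2
    rw [Finset.sum_add_distrib, ← Finset.mul_sum, ← Finset.mul_sum] at e0
    set S := ∑ m ∈ Finset.range (N i), Complex.log (1 + dev t A u (b, m))
    set S1 := ∑ m ∈ Finset.range (N i), coeffOne A u (b * (2 * m + 1))
    set S2 := ∑ m ∈ Finset.range (N i), coeffTwo A u (b * (2 * m + 1))
    set H1 := antiOne A u (2 * b * N i)
    set H2 := antiTwo A u (2 * b * N i)
    have hid : S + (-((u * I * (π ^ 2 / 12) + A / 2) / (2 * τ))) - c =
        (S - (τ * S1 + (τ : ℂ) ^ 2 * S2)) +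
        (1 / (2 * τ) * (2 * b * S1 - (H1 - -(A / 2))) +
         1 / (2 * τ) * (H1 - u * I * (π ^ 2 / 12))) +
        (1 / 2 * (2 * b * S2 - (H2 - (-(u * A * I / 2) - A ^ 2 / 8))) +
         1 / 2 * (H2 - (-(u ^ 2 * (π ^ 2 / 12))))) := by
      rw [hc, ← hτbc]
      field_simp
      ring
    have hn : ‖(1 / (2 * τ) : ℂ)‖ = 1 / (2 * τ) := by
      rw [norm_div, norm_mul, Complex.norm_real, Real.norm_of_nonneg hτ.le]
      norm_num
    have f1 : ‖1 / (2 * τ) * (2 * b * S1 - (H1 - -(A / 2)))‖ ≤ |C1| / 2 * τ := by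
      rw [norm_mul, hn]
      calc _ ≤ 1 / (2 * τ) * (|C1| * b) := by
            gcongr
            exact e1.trans (by gcongr; exact le_abs_self _)
        _ = |C1| / 2 * τ := by
            rw [← hτb]
            field_simp
    have f2 : ‖1 / (2 * τ) * (H1 - u * I * (π ^ 2 / 12))‖ ≤ 2 * D1 * τ := by
      rw [norm_mul, hn]
      calc _ ≤ 1 / (2 * τ) * (D1 * (4 * b)) := by
            gcongr
            refine e3.trans ?_
            rw [div_eq_mul_one_div]
            gcongr
        _ = _ := by
            rw [← hτb]
            field_simp
            ring
    have f3 : ‖1 / 2 * (2 * b * S2 - (H2 - (-(u * A * I / 2) - A ^ 2 / 8)))‖ ≤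
        |C2| / 2 * τ := by
      rw [norm_mul]
      calc _ ≤ 1 / 2 * (|C2| * τ) := by
            gcongr
            · norm_num
            · exact e2.trans (by gcongr; exact le_abs_self _)
        _ = _ := by ring
    have f4 : ‖1 / 2 * (H2 - (-(u ^ 2 * (π ^ 2 / 12))))‖ ≤ 2 * D2 * τ := by
      rw [norm_mul]
      calc _ ≤ 1 / 2 * (D2 * (4 * τ)) := by
            gcongr
            · norm_num
            · refine e4.trans ?_
              rw [div_eq_mul_one_div]
              gcongr
              linarith
        _ = _ := by ring
    rw [hid]
    refine norm_add₃_le.trans ?_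
    have g1 := norm_add_le (1 / (2 * τ) * (2 * b * S1 - (H1 - -(A / 2))))
      (1 / (2 * τ) * (H1 - u * I * (π ^ 2 / 12)))
    have g2 := norm_add_le (1 / 2 * (2 * b * S2 - (H2 - (-(u * A * I / 2) - A ^ 2 / 8))))
      (1 / 2 * (H2 - (-(u ^ 2 * (π ^ 2 / 12)))))
    linarith
  refine ((Complex.continuous_exp.tendsto c).comp hE).congr' ?_
  filter_upwards [hβ.eventually h0] with i h0
  rw [(h0 (N i)).1, ← Complex.exp_add]
  rfl

/-- The exponential sum of descents over the subsets that encode the self-conjugate partitions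
of `n`. -/
noncomputable def mgfSum (t : ℕ) (lam : ℝ) (n : ℕ) : ℝ :=
  ∑ E ∈ (Finset.range n).powerset.filter (fun E => ∑ e ∈ E, (2 * e + 1) = n),
    Real.exp (lam * descents t E)

lemma integral_cexp_int (k : ℤ) :
    ∫ θ in (-π)..π, cexp (k * I * θ) = if k = 0 then 2 * (π : ℂ) else 0 := by
  split_ifs with h
  · subst h
    simp
    ring
  · have hk : (k * I : ℂ) ≠ 0 := mul_ne_zero (by exact_mod_cast h) I_ne_zero
    rw [integral_exp_mul_complex hk, div_eq_zero_iff, sub_eq_zero]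
    left
    rw [Complex.exp_eq_exp_iff_exists_int]
    refine ⟨k, ?_⟩
    push_cast
    ring

lemma prod_bw (β θ : ℝ) (E : Finset ℕ) :
    ∏ m ∈ E, bw β θ m = cexp ((-β + θ * I) * (∑ e ∈ E, (2 * e + 1) : ℕ)) := by
  simp only [bw]
  rw [← Complex.exp_sum, ← Finset.mul_sum]
  push_cast
  rfl

lemma continuous_partFun_bw (t : ℕ) (T : ℂ) (β : ℝ) (N : ℕ) :
    Continuous fun θ : ℝ => partFun t T (bw β θ) N := by
  simp only [partFun, wt, prod_bw]
  fun_prop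

lemma integral_partFun_bw (t : ℕ) (lam β : ℝ) (n : ℕ) :
    ∫ θ in (-π)..π, partFun t (Real.exp lam : ℝ) (bw β θ) n * cexp (-(n * θ * I)) =
      (2 * π * Real.exp (-β * n) * mgfSum t lam n : ℝ) := by
  have h1 : ∀ θ : ℝ, partFun t (Real.exp lam : ℝ) (bw β θ) n * cexp (-(n * θ * I)) =
      ∑ E ∈ (Finset.range n).powerset, (Real.exp (lam * descents t E) : ℂ) *
        cexp (-β * (∑ e ∈ E, (2 * e + 1) : ℕ)) *
          cexp (((∑ e ∈ E, (2 * e + 1) : ℕ) - n : ℤ) * I * θ) := by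
    intro θ
    rw [partFun, Finset.sum_mul]
    refine Finset.sum_congr rfl fun E _ => ?_
    rw [wt, prod_bw, ← Complex.ofReal_pow, ← Real.exp_nat_mul, 
      mul_comm _ lam, mul_assoc, ← Complex.exp_add,
      mul_assoc ((Real.exp (lam * descents t E) : ℝ) : ℂ), ← Complex.exp_add]
    congr 2
    push_cast
    ring
  simp only [h1]
  rw [intervalIntegral.integral_finsetSum]
  · simp only [intervalIntegral.integral_const_mul, integral_cexp_int]
    rw [mgfSum, Finset.mul_sum, Complex.ofReal_sum, Finset.sum_filter]
    refine Finset.sum_congr rfl fun E _ => ?_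
    simp only [sub_eq_zero, Nat.cast_inj]
    split_ifs with h
    · rw [h]
      push_cast
      ring
    · simp
  · intro E _
    exact Continuous.intervalIntegrable (by fun_prop) _ _

/-- The normalising factor of the partition function. -/
noncomputable def fermiProd (β : ℝ) (N : ℕ) : ℝ :=
  ∏ m ∈ Finset.range N, (1 - fermi (β * (2 * m + 1)))

lemma fermi_lt_one (x : ℝ) : fermi x < 1 := by
  rw [fermi, div_lt_one (by positivity)]
  linarith [Real.exp_pos x]

lemma fermiProd_pos (β : ℝ) (N : ℕ) : 0 < fermiProd β N :=
  Finset.prod_pos fun _ _ => sub_pos.2 (fermi_lt_one _)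

lemma fermiProd_mul_partFun {t : ℕ} (ht : 1 ≤ t) (A u : ℝ) {β : ℝ} (hβ : 0 < β)
    (h1 : |u| * √β ≤ 1 / 4) (h2 : ‖cexp (A * √β) - 1‖ ≤ 1 / 8) (N : ℕ) :
    (fermiProd β N : ℂ) * partFun t (Real.exp (A * √β) : ℝ) (bw β (u * √β ^ 3)) N =
      ∏ m ∈ Finset.range N, (1 + dev t A u (β, m)) := by
  have hmul := fun m : ℕ => transferR_mul t A u (x := (β, m)) hβ
  have hne : ∀ m : ℕ, 1 + dev t A u (β, m) ≠ 0 := fun m h => by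
    have h3 := (transferC_bound ht A u hβ h1 h2 m).2
    rw [← neg_eq_iff_add_eq_zero.2 h, norm_neg, norm_one] at h3
    norm_num at h3
  rw [partFun_eq_prod ht, fermiProd, Complex.ofReal_prod, ← Finset.prod_mul_distrib]
  · refine Finset.prod_congr rfl fun m _ => ?_
    rw [← hmul]
    push_cast
    rfl
  · intro m _ h
    refine hne m ?_
    rw [← hmul]
    simp only [h, mul_zero]

lemma tendsto_fermiProd_mul_partFun {t : ℕ} (ht : 1 ≤ t) (A u : ℝ) {ι : Type*} {l : Filter ι}
    {β : ι → ℝ} {N : ι → ℕ} (hβ : Tendsto β l (𝓝[>] 0)) (hN : ∀ᶠ i in l, 1 / 8 ≤ β i ^ 2 * N i) :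
    Tendsto (fun i => (fermiProd (β i) (N i) : ℂ) *
        partFun t (Real.exp (A * √(β i)) : ℝ) (bw (β i) (u * √(β i) ^ 3)) (N i) *
        cexp (-((u * I * (π ^ 2 / 12) + A / 2) / (2 * √(β i))))) l
      (𝓝 (cexp (-(u ^ 2 * π ^ 2 / 24) + u * I * A / 4 + A ^ 2 / 16))) := by
  refine (tendsto_prod_dev ht A u hβ hN).congr' ?_
  have hs : Tendsto (fun i => √(β i)) l (𝓝 0) := by
    have := (Real.continuous_sqrt.tendsto 0).comp (hβ.mono_right nhdsWithin_le_nhds)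
    rwa [Real.sqrt_zero] at this
  have e1 : ∀ᶠ i in l, |u| * √(β i) < 1 / 4 := by
    have := hs.const_mul |u|
    rw [mul_zero] at this
    exact this.eventually_lt_const (by norm_num)
  have e2 : ∀ᶠ i in l, ‖cexp (A * √(β i)) - 1‖ < 1 / 8 := by
    have hc : Continuous fun x : ℝ => ‖cexp (A * x) - 1‖ := by fun_prop
    have := (hc.tendsto 0).comp hs
    simp only [ofReal_zero, mul_zero, Complex.exp_zero, sub_self, norm_zero] at this
    exact this.eventually_lt_const (by norm_num)
  filter_upwards [e1, e2, hβ.eventually self_mem_nhdsWithin] with i h1 h2 h3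
  rw [fermiProd_mul_partFun ht A u h3 h1.le h2.le]

lemma exp_neg_le_inv_one_add_sq {u m : ℝ} (h1 : u ^ 2 ≤ 40 * m ∨ u ^ 2 ≤ 640 * m ^ 3)
    (hm : 0 ≤ m) : Real.exp (-(1 / 100 * m)) ≤ 10 ^ 10 * (1 + u ^ 2)⁻¹ := by
  have h2 := Real.pow_div_factorial_le_exp (1 / 100 * m) (by positivity) 3
  have h3 := Real.add_one_le_exp (1 / 100 * m)
  rw [Real.exp_neg, ← div_eq_mul_inv, inv_eq_one_div, div_le_div_iff₀ (Real.exp_pos _) (by positivity)]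
  norm_num [Nat.factorial] at h2
  rcases h1 with h1 | h1 <;> nlinarith [pow_nonneg hm 3]

lemma norm_partFun_bw_le_inv {t : ℕ} (ht : 1 ≤ t) {β lam u : ℝ} (hβ : 0 < β)
    (hβ1 : β ≤ 1) (hlam : |lam| ≤ 1) (hu : |u * √β ^ 3| ≤ π) {N : ℕ} (hN : 1 ≤ β * N) :
    ‖partFun t (Real.exp lam : ℝ) (bw β (u * √β ^ 3)) N‖ ≤
      10 ^ 10 * (1 + u ^ 2)⁻¹ * ‖partFun t (Real.exp lam : ℝ) (bw β 0) N‖ := by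
  have hinv : 1 ≤ 1 / β := by rwa [le_div_iff₀ hβ, one_mul]
  set L := ⌊1 / β⌋₊ with hL
  have hL1 : 1 ≤ L := Nat.le_floor (by exact_mod_cast hinv)
  have hLle : (L : ℝ) ≤ 1 / β := Nat.floor_le (by positivity)
  have hβL : β * L ≤ 1 := by
    rw [le_div_iff₀ hβ] at hLle
    linarith
  have hLN : L ≤ N := by
    have : (L : ℝ) ≤ N := hLle.trans (by rw [div_le_iff₀ hβ]; linarith)
    exact_mod_cast this
  have hLlt : 1 / β < L + 1 := Nat.lt_floor_add_one _
  have hL1' : (1 : ℝ) ≤ L := by exact_mod_cast hL1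
  have h2 : 1 ≤ 2 * (β * L) := by
    rw [div_lt_iff₀ hβ] at hLlt
    nlinarith
  refine (norm_partFun_bw_le ht hβ hlam hu hL1 hLN hβL).trans ?_
  gcongr
  have hs : √β ^ 2 = β := Real.sq_sqrt hβ.le
  have hθ : (u * √β ^ 3) ^ 2 = u ^ 2 * β ^ 3 := by
    rw [mul_pow, ← pow_mul, show 3 * 2 = 2 * 3 by norm_num, pow_mul, hs]
  refine exp_neg_le_inv_one_add_sq ?_ (by positivity)
  rcases min_cases ((L : ℝ) / 2) ((u * √β ^ 3) ^ 2 * L ^ 3 / 5) with ⟨h, _⟩ | ⟨h, _⟩ <;> rw [h]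
  · right
    have h4 : u ^ 2 * β ^ 3 ≤ 10 := by
      rw [← hθ, ← sq_abs]
      have := Real.pi_lt_d2
      nlinarith [abs_nonneg (u * √β ^ 3)]
    have h5 : 1 ≤ (2 * (β * L)) ^ 3 := one_le_pow₀ h2
    have h6 : u ^ 2 * β ^ 3 ≤ (80 * L ^ 3) * β ^ 3 := by nlinarith
    have := le_of_mul_le_mul_right h6 (by positivity)
    nlinarith
  · left
    rw [hθ]
    have h5 : 1 ≤ (2 * (β * L)) ^ 3 := one_le_pow₀ h2
    nlinarith [sq_nonneg u]

/-- The integrand of the rescaled Fourier inversion formula. -/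
noncomputable def fourierInt (t : ℕ) (A β : ℝ) (n : ℕ) (u : ℝ) : ℂ :=
  (fermiProd β n : ℂ) * partFun t (Real.exp (A * √β) : ℝ) (bw β (u * √β ^ 3)) n *
    cexp (-(n * (u * √β ^ 3 : ℝ) * I)) * (Real.exp (-(A / (4 * √β))) : ℝ)

/-- The saddle point for self-conjugate partitions of `n`. -/
noncomputable def saddle (n : ℕ) : ℝ := π / √(24 * n)

lemma saddle_pos {n : ℕ} (hn : 1 ≤ n) : 0 < saddle n := by
  have : (0 : ℝ) < n := by exact_mod_cast hn
  rw [saddle]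
  positivity

lemma saddle_sq_mul {n : ℕ} (hn : 1 ≤ n) : saddle n ^ 2 * n = π ^ 2 / 24 := by
  have : (0 : ℝ) < n := by exact_mod_cast hn
  rw [saddle, div_pow, Real.sq_sqrt (by positivity)]
  field_simp

lemma tendsto_saddle : Tendsto saddle atTop (𝓝[>] 0) := by
  refine tendsto_nhdsWithin_iff.2 ⟨?_, ?_⟩
  · have h1 : Tendsto (fun n : ℕ => √(24 * n)) atTop atTop :=
      Real.tendsto_sqrt_atTop.comp (tendsto_natCast_atTop_atTop.const_mul_atTop (by norm_num))
    exact h1.const_div_atTop π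
  · filter_upwards [eventually_ge_atTop 1] with n hn using saddle_pos hn

lemma tendsto_sqrt_saddle : Tendsto (fun n => √(saddle n)) atTop (𝓝 0) := by
  have := (Real.continuous_sqrt.tendsto 0).comp (tendsto_saddle.mono_right nhdsWithin_le_nhds)
  rwa [Real.sqrt_zero] at this

lemma one_le_saddle_mul : ∀ᶠ n : ℕ in atTop, 1 ≤ saddle n * n := by
  have h1 : Tendsto (fun n => saddle n) atTop (𝓝 0) :=
    tendsto_saddle.mono_right nhdsWithin_le_nhds
  filter_upwards [eventually_ge_atTop 1, h1.eventually_lt_const (show (0 : ℝ) < 3 / 8 by norm_num)]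
    with n hn h
  have h2 := saddle_sq_mul hn
  have h3 := saddle_pos hn
  have h4 : (9 : ℝ) / 24 ≤ saddle n * (saddle n * n) := by
    have := Real.pi_gt_three
    nlinarith
  by_contra! h5
  nlinarith

lemma sqrt_cube_mul {n : ℕ} (hn : 1 ≤ n) : n * √(saddle n) ^ 3 = π ^ 2 / 12 / (2 * √(saddle n)) := by
  have h1 := Real.sqrt_pos.2 (saddle_pos hn)
  have h2 : √(saddle n) ^ 2 = saddle n := Real.sq_sqrt (saddle_pos hn).le
  have h3 := saddle_sq_mul hn
  rw [eq_div_iff (by positivity)]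
  calc _ = 2 * ((√(saddle n) ^ 2) ^ 2 * n) := by ring
    _ = _ := by
      rw [h2, h3]
      ring

lemma tendsto_fourierInt {t : ℕ} (ht : 1 ≤ t) (A u : ℝ) :
    Tendsto (fun n => fourierInt t A (saddle n) n u) atTop
      (𝓝 (cexp (-(u ^ 2 * π ^ 2 / 24) + u * I * A / 4 + A ^ 2 / 16))) := by
  have h := tendsto_fermiProd_mul_partFun ht A u tendsto_saddle (N := id) (by
    filter_upwards [eventually_ge_atTop 1] with n hn
    rw [id, saddle_sq_mul hn]
    have := Real.pi_gt_three
    nlinarith)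
  refine h.congr' ?_
  filter_upwards [eventually_ge_atTop 1] with n hn
  rw [fourierInt, mul_assoc _ (cexp _), Complex.ofReal_exp (-(A / _)), ← Complex.exp_add]
  simp only [id]
  congr 2
  rw [mul_comm u, ← Complex.ofReal_natCast, ← Complex.ofReal_mul, ← mul_assoc, sqrt_cube_mul hn]
  have h1 : (√(saddle n) : ℂ) ≠ 0 := by
    exact_mod_cast (Real.sqrt_pos.2 (saddle_pos hn)).ne'
  push_cast
  field_simp
  ring

lemma norm_fourierInt_le {t : ℕ} (ht : 1 ≤ t) {A β u : ℝ} (hβ : 0 < β) (hβ1 : β ≤ 1)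
    (hA : |A * √β| ≤ 1) (hu : |u * √β ^ 3| ≤ π) {N : ℕ} (hN : 1 ≤ β * N) :
    ‖fourierInt t A β N u‖ ≤ 10 ^ 10 * (1 + u ^ 2)⁻¹ * ‖fourierInt t A β N 0‖ := by
  have h := norm_partFun_bw_le_inv ht hβ hβ1 hA hu hN
  have h1 : ∀ x : ℝ, ‖cexp (-(N * x * I))‖ = 1 := fun x => by
    rw [Complex.norm_exp]
    simp
  simp only [fourierInt, norm_mul, h1, zero_mul]
  calc _ ≤ ‖(fermiProd β N : ℂ)‖ * (10 ^ 10 * (1 + u ^ 2)⁻¹ *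
        ‖partFun t (Real.exp (A * √β) : ℝ) (bw β 0) N‖) * 1 *
        ‖((Real.exp (-(A / (4 * √β))) : ℝ) : ℂ)‖ := by gcongr
    _ = _ := by ring

lemma integral_fourierInt (t : ℕ) (A : ℝ) {β : ℝ} (hβ : 0 < β) (n : ℕ) :
    ∫ u in (-(π / √β ^ 3))..(π / √β ^ 3), fourierInt t A β n u =
      (fermiProd β n * Real.exp (-(A / (4 * √β))) * (2 * π * Real.exp (-β * n)) / √β ^ 3 *
        mgfSum t (A * √β) n : ℝ) := by
  have hτ : 0 < √β ^ 3 := pow_pos (Real.sqrt_pos.2 hβ) 3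
  have h := intervalIntegral.smul_integral_comp_mul_right (a := -(π / √β ^ 3)) (b := π / √β ^ 3)
    (fun θ : ℝ => partFun t (Real.exp (A * √β) : ℝ) (bw β θ) n * cexp (-(n * θ * I))) (√β ^ 3)
  rw [neg_mul, div_mul_cancel₀ _ hτ.ne', integral_partFun_bw, Complex.real_smul] at h
  have h2 : ∀ u : ℝ, fourierInt t A β n u =
      ((fermiProd β n : ℂ) * (Real.exp (-(A / (4 * √β))) : ℝ)) *
      (partFun t (Real.exp (A * √β) : ℝ) (bw β (u * √β ^ 3)) n *
        cexp (-(n * (u * √β ^ 3 : ℝ) * I))) := by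
    intro u
    rw [fourierInt]
    ring
  simp only [h2]
  rw [intervalIntegral.integral_const_mul]
  have hτ' : ((√β ^ 3 : ℝ) : ℂ) ≠ 0 := by exact_mod_cast hτ.ne'
  rw [eq_div_of_mul_eq hτ' ((mul_comm _ _).trans h)]
  push_cast
  ring

lemma tendsto_integral_fourierInt {t : ℕ} (ht : 1 ≤ t) (A : ℝ) :
    Tendsto (fun n => ∫ u in (-(π / √(saddle n) ^ 3))..(π / √(saddle n) ^ 3),
      fourierInt t A (saddle n) n u) atTop
      (𝓝 (∫ u : ℝ, cexp (-(u ^ 2 * π ^ 2 / 24) + u * I * A / 4 + A ^ 2 / 16))) := by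
  have hpos : ∀ᶠ n : ℕ in atTop, 0 < √(saddle n) ^ 3 := by
    filter_upwards [eventually_ge_atTop 1] with n hn
    exact pow_pos (Real.sqrt_pos.2 (saddle_pos hn)) 3
  obtain ⟨C, hC⟩ := (tendsto_fourierInt ht A 0).norm.bddAbove_range
  have hC' : ∀ n, ‖fourierInt t A (saddle n) n 0‖ ≤ C := fun n => hC ⟨n, rfl⟩
  have key : Tendsto (fun n => ∫ u : ℝ,
      (Set.Ioc (-(π / √(saddle n) ^ 3)) (π / √(saddle n) ^ 3)).indicator
        (fourierInt t A (saddle n) n) u) atTop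
      (𝓝 (∫ u : ℝ, cexp (-(u ^ 2 * π ^ 2 / 24) + u * I * A / 4 + A ^ 2 / 16))) := by
    refine MeasureTheory.tendsto_integral_filter_of_dominated_convergence
      (fun u => 10 ^ 10 * (1 + u ^ 2)⁻¹ * C) ?_ ?_ ?_ ?_
    · refine Eventually.of_forall fun n => ?_
      refine (Continuous.aestronglyMeasurable ?_).indicator measurableSet_Ioc
      have h1 := (continuous_partFun_bw t (Real.exp (A * √(saddle n)) : ℝ) (saddle n) n).comp
        (continuous_mul_const (√(saddle n) ^ 3))
      unfold fourierInt
      refine ((continuous_const.mul h1).mul ?_).mul continuous_const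
      fun_prop
    · have e1 : ∀ᶠ n : ℕ in atTop, |A * √(saddle n)| < 1 := by
        have := (tendsto_sqrt_saddle.const_mul A).abs
        rw [mul_zero, abs_zero] at this
        exact this.eventually_lt_const one_pos
      have e2 : ∀ᶠ n : ℕ in atTop, saddle n < 1 :=
        (tendsto_saddle.mono_right nhdsWithin_le_nhds).eventually_lt_const one_pos
      filter_upwards [hpos, e1, e2, one_le_saddle_mul, eventually_ge_atTop 1]
        with n hn h1 h2 h3 h4
      refine Eventually.of_forall fun u => ?_
      have hC0 : 0 ≤ C := (norm_nonneg _).trans (hC' n)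
      by_cases hu : u ∈ Set.Ioc (-(π / √(saddle n) ^ 3)) (π / √(saddle n) ^ 3)
      · rw [Set.indicator_of_mem hu]
        refine (norm_fourierInt_le ht (saddle_pos h4) h2.le h1.le ?_ h3).trans ?_
        · rw [abs_mul, abs_of_pos hn, ← le_div_iff₀ hn]
          exact abs_le.2 ⟨hu.1.le, hu.2⟩
        · gcongr
          exact hC' n
      · rw [Set.indicator_of_notMem hu, norm_zero]
        positivity
    · exact (integrable_inv_one_add_sq.const_mul _).mul_const C
    · refine Eventually.of_forall fun u => ?_
      refine (tendsto_fourierInt ht A u).congr' ?_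
      have h1 : Tendsto (fun n => |u| * √(saddle n) ^ 3) atTop (𝓝 0) := by
        simpa using (tendsto_sqrt_saddle.pow 3).const_mul |u|
      filter_upwards [hpos, h1.eventually_lt_const Real.pi_pos] with n hn h
      rw [Set.indicator_of_mem]
      rw [← lt_div_iff₀ hn] at h
      exact ⟨(abs_lt.1 h).1, (abs_lt.1 h).2.le⟩
  refine key.congr' ?_
  filter_upwards [hpos] with n hn
  have : 0 < π / √(saddle n) ^ 3 := by positivity
  rw [MeasureTheory.integral_indicator measurableSet_Ioc,
    intervalIntegral.integral_of_le (by linarith)]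

lemma integral_limit (A : ℝ) :
    ∫ u : ℝ, cexp (-(u ^ 2 * π ^ 2 / 24) + u * I * A / 4 + A ^ 2 / 16) =
      ((24 / π) ^ (1 / 2 : ℂ)) * (Real.exp (A ^ 2 * (π ^ 2 - 6) / (16 * π ^ 2)) : ℝ) := by
  have hπ : (π : ℂ) ≠ 0 := by exact_mod_cast Real.pi_ne_zero
  have h := integral_cexp_quadratic (b := ((-(π ^ 2 / 24) : ℝ) : ℂ))
    (by rw [Complex.ofReal_re]; have := Real.pi_pos; simp; positivity) (I * A / 4) (A ^ 2 / 16)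
  convert h using 2
  · ext u
    congr 1
    push_cast
    ring
  · congr 1
    push_cast
    field_simp
  · rw [Complex.ofReal_exp]
    congr 1
    push_cast
    field_simp
    rw [I_sq]
    ring

lemma tendsto_mgfSum {t : ℕ} (ht : 1 ≤ t) (A : ℝ) :
    Tendsto (fun n => mgfSum t (A * √(saddle n)) n / mgfSum t 0 n *
      Real.exp (-(A / (4 * √(saddle n))))) atTop
      (𝓝 (Real.exp (A ^ 2 * (π ^ 2 - 6) / (16 * π ^ 2)))) := by
  have h0 : ((24 : ℂ) / π) ^ (1 / 2 : ℂ) ≠ 0 := by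
    rw [Ne, Complex.cpow_eq_zero_iff]
    simp [Real.pi_ne_zero]
  have hA := tendsto_integral_fourierInt ht A
  have hZ := tendsto_integral_fourierInt ht 0
  rw [integral_limit] at hA hZ
  have h := hA.div hZ (mul_ne_zero h0 (by exact_mod_cast (Real.exp_pos _).ne'))
  simp only [ne_eq, OfNat.ofNat_ne_zero, not_false_eq_true, zero_pow, zero_mul, zero_div,
    Real.exp_zero, ofReal_one, mul_one] at h
  rw [mul_div_cancel_left₀ _ h0] at h
  have h' := (Complex.continuous_re.tendsto _).comp h
  rw [Complex.ofReal_re] at h'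
  refine h'.congr' ?_
  filter_upwards [eventually_ge_atTop 1] with n hn
  have hβ := saddle_pos hn
  rw [Function.comp, Pi.div_apply, integral_fourierInt t A hβ, integral_fourierInt t 0 hβ,
    ← Complex.ofReal_div, Complex.ofReal_re]
  have h1 := fermiProd_pos (saddle n) n
  have h2 := Real.sqrt_pos.2 hβ
  have h3 := Real.exp_pos (-saddle n * n)
  simp only [zero_div, neg_zero, Real.exp_zero, zero_mul]
  field_simp

lemma sqrt_six_mul_div_pi {n : ℕ} (hn : 1 ≤ n) : √(6 * n) / π = 1 / (2 * saddle n) := by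
  have hn' : (0 : ℝ) < n := by exact_mod_cast hn
  have h : √(24 * n) = 2 * √(6 * n) := by
    rw [show (24 * n : ℝ) = 2 ^ 2 * (6 * n) by ring, Real.sqrt_mul (by norm_num),
      Real.sqrt_sq (by norm_num)]
  rw [saddle, h]
  field_simp

lemma div_sigma_eq {n : ℕ} (hn : 1 ≤ n) (r : ℝ) :
    r / √((π ^ 2 - 6) * √(6 * n) / π ^ 3) =
      r / √((π ^ 2 - 6) / (2 * π ^ 2)) * √(saddle n) := by
  have hβ := saddle_pos hn
  have h1 : (π ^ 2 - 6) * √(6 * n) / π ^ 3 = (π ^ 2 - 6) / (2 * π ^ 2) / saddle n := by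
    calc _ = (π ^ 2 - 6) / π ^ 2 * (√(6 * n) / π) := by
          field_simp
      _ = _ := by
          rw [sqrt_six_mul_div_pi hn]
          field_simp
  rw [h1, Real.sqrt_div' _ hβ.le, div_div_eq_mul_div]
  ring

lemma card_SC_eq (t n : ℕ) : ((SC n).card : ℝ) = mgfSum t 0 n := by
  rw [mgfSum]
  simp only [zero_mul, Real.exp_zero]
  rw [← sum_SC_eq le_rfl fun _ => 1]
  simp

lemma sum_SC_exp_eq (t n : ℕ) (lam : ℝ) :
    ∑ P ∈ SC n, Real.exp (lam * descents t (frobP P)) = mgfSum t lam n :=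
  sum_SC_eq le_rfl fun E => Real.exp (lam * descents t E)

lemma abs_exponent_sub_le {t n : ℕ} (ht : 1 ≤ t) (hn : 1 ≤ n) {P : n.Partition} (hP : P ∈ SC n)
    (r c : ℝ) :
    |r * ((Nhook t P : ℝ) - (√(6 * n) / π + c)) / √((π ^ 2 - 6) * √(6 * n) / π ^ 3) -
      (2 * r / √((π ^ 2 - 6) / (2 * π ^ 2)) * √(saddle n) * descents t (frobP P) -
        2 * r / √((π ^ 2 - 6) / (2 * π ^ 2)) / (4 * √(saddle n)))| ≤
      |r / √((π ^ 2 - 6) / (2 * π ^ 2))| * (t + |c|) * √(saddle n) := by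
  obtain ⟨h1, h2⟩ := Nhook_bounds ht (Finset.mem_filter.1 hP).2
  have h1' : (2 * descents t (frobP P) : ℝ) ≤ Nhook t P := by exact_mod_cast h1
  have h2' : (Nhook t P : ℝ) ≤ 2 * descents t (frobP P) + t := by exact_mod_cast h2
  have hβ := saddle_pos hn
  have hs := Real.sqrt_pos.2 hβ
  have hsq : √(saddle n) ^ 2 = saddle n := Real.sq_sqrt hβ.le
  rw [mul_div_right_comm, div_sigma_eq hn, sqrt_six_mul_div_pi hn, mul_div_assoc 2 r]
  set a := r / √((π ^ 2 - 6) / (2 * π ^ 2))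
  have h3 : a * √(saddle n) * ((Nhook t P : ℝ) - (1 / (2 * saddle n) + c)) -
      (2 * a * √(saddle n) * descents t (frobP P) - 2 * a / (4 * √(saddle n))) =
      a * ((Nhook t P - 2 * descents t (frobP P)) - c) * √(saddle n) := by
    have h4 : √(saddle n) * (1 / (2 * saddle n)) = 2 / (4 * √(saddle n)) := by
      rw [mul_one_div, div_eq_div_iff (by positivity) (by positivity)]
      linear_combination 4 * hsq
    linear_combination -a * h4
  rw [h3, abs_mul, abs_mul, abs_of_pos hs]
  gcongr
  refine (abs_sub _ _).trans ?_
  gcongr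
  exact abs_le.2 ⟨by linarith [Nat.cast_nonneg (α := ℝ) t], by linarith⟩

lemma tendsto_average {t : ℕ} (ht : 1 ≤ t) (r c : ℝ) :
    Tendsto (fun n : ℕ => (1 / ((SC n).card : ℝ)) * ∑ P ∈ SC n,
      Real.exp (r * ((Nhook t P : ℝ) - (√(6 * n) / π + c)) /
        √((π ^ 2 - 6) * √(6 * n) / π ^ 3))) atTop (𝓝 (Real.exp (r ^ 2 / 2))) := by
  have hpi : 0 < π ^ 2 - 6 := by
    have := Real.pi_gt_three
    nlinarith
  set s := √((π ^ 2 - 6) / (2 * π ^ 2)) with hs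
  have hs2 : s ^ 2 = (π ^ 2 - 6) / (2 * π ^ 2) := Real.sq_sqrt (by positivity)
  have hs0 : 0 < s := Real.sqrt_pos.2 (by positivity)
  have h := tendsto_mgfSum ht (2 * r / s)
  have hlim : (2 * r / s) ^ 2 * (π ^ 2 - 6) / (16 * π ^ 2) = r ^ 2 / 2 := by
    rw [div_pow, hs2]
    field_simp
    ring
  rw [hlim] at h
  set K := |r / s| * (t + |c|)
  have hexp : ∀ k : ℝ, Tendsto (fun n => Real.exp (k * √(saddle n))) atTop (𝓝 1) := fun k => by
    have := (Real.continuous_exp.tendsto _).comp (tendsto_sqrt_saddle.const_mul k)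
    rwa [mul_zero, Real.exp_zero] at this
  have hlow := (hexp (-K)).mul h
  have hupp := (hexp K).mul h
  rw [one_mul] at hlow hupp
  have hrw : ∀ (k : ℝ) (n : ℕ), Real.exp k *
      (mgfSum t (2 * r / s * √(saddle n)) n / mgfSum t 0 n *
      Real.exp (-(2 * r / s / (4 * √(saddle n))))) = (1 / ((SC n).card : ℝ)) * ∑ P ∈ SC n,
        Real.exp (k + (2 * r / s * √(saddle n) * descents t (frobP P) -
          2 * r / s / (4 * √(saddle n)))) := by
    intro k n
    simp only [Real.exp_add, Real.exp_sub, ← Finset.mul_sum]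
    rw [← Finset.sum_div, sum_SC_exp_eq, card_SC_eq t, Real.exp_neg]
    ring
  refine tendsto_of_tendsto_of_tendsto_of_le_of_le' hlow hupp ?_ ?_ <;>
  · filter_upwards [eventually_ge_atTop 1] with n hn
    rw [hrw]
    gcongr with P hP
    have := abs_le.1 (abs_exponent_sub_le ht hn hP r c)
    linarith [this.1, this.2]

end

/-- The normalized moment generating function of `N_t` on `SC(n)` converges
pointwise to that of the standard Gaussian. -/
theorem stmt17 (t : ℕ) (ht : 1 ≤ t) (r : ℝ) :
    Filter.Tendsto (fun n : ℕ =>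
        (1 / ((SC n).card : ℝ)) * ∑ P ∈ SC n,
          Real.exp (r * ((Nhook t P : ℝ)
              - (Real.sqrt (6*n)/π - t/2 + 3/π^2 + delta t/4))
            / Real.sqrt ((π^2 - 6) * Real.sqrt (6*n) / π^3)))
      Filter.atTop (nhds (Real.exp (r^2/2))) := by
  refine (tendsto_average ht r (-(t / 2) + 3 / π ^ 2 + delta t / 4)).congr fun n => ?_
  rw [show √(6 * n) / π - t / 2 + 3 / π ^ 2 + delta t / 4 =
    √(6 * n) / π + (-(t / 2) + 3 / π ^ 2 + delta t / 4) by ring]
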